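/- arXiv:1901.02135 — 3 statements merged into one kernel-verified Lean document; each statement's English description precedes it below -/
import Mathlib

section
/- Let (X,d) be a compact metric space, φ a continuous flow on X without fixed points, and μ a φ-invariant Borel probability measure. Then for every τ∈ℝ\{0}, ∫_X underline h_μ(φ,x) dμ(x) ≥ (1/|τ|) h_μ(φ_τ), where h_μ(φ_τ) is the measure-theoretic entropy of the time-τ map φ_τ with respect to μ. -/
open MeasureTheory Filter Set Topology
open scoped ENNReal NNReal

namespace FlowEntropy

variable {X : Type*}

/-- A continuous flow on `X`. -/
structure IsFlow [TopologicalSpace X] (φ : ℝ → X → X) : Prop where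
  cont : Continuous fun p : ℝ × X => φ p.1 p.2
  map_zero : ∀ x, φ 0 x = x
  map_add : ∀ s t : ℝ, ∀ x, φ (s + t) x = φ s (φ t x)

/-- The flow has no fixed points. -/
def FixedPointFree (φ : ℝ → X → X) : Prop :=
  ∀ x : X, ∃ t : ℝ, φ t x ≠ x

/-- The measure `μ` is invariant under every time-`t` map of the flow. -/
def FlowInvariant [MeasurableSpace X] (φ : ℝ → X → X) (μ : Measure X) : Prop :=
  ∀ t : ℝ, MeasurePreserving (φ t) μ μ

/-- The measure `μ` is invariant and ergodic for the flow: every Borel set invariant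
under all time-`t` maps has measure `0` or `1`. -/
def FlowErgodic [MeasurableSpace X] (φ : ℝ → X → X) (μ : Measure X) : Prop :=
  FlowInvariant φ μ ∧
    ∀ B : Set X, MeasurableSet B → (∀ t : ℝ, φ t ⁻¹' B = B) → μ B = 0 ∨ μ B = 1

/-- `α` is a reparametrization on the closed interval `I` (containing the origin):
a continuous map that is a homeomorphism onto its image (equivalently, continuous and
injective on the compact interval), fixing the origin. -/
def IsReparOn (α : ℝ → ℝ) (I : Set ℝ) : Prop :=
  ContinuousOn α I ∧ Set.InjOn α I ∧ α 0 = 0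

/-- The reparametrization ball `B(x, t, ε, φ)`. -/
def reparBall [PseudoMetricSpace X] (φ : ℝ → X → X) (x : X) (t ε : ℝ) : Set X :=
  {y : X | ∃ α : ℝ → ℝ, IsReparOn α (Set.Icc 0 t) ∧
      ∀ s ∈ Set.Icc (0 : ℝ) t, dist (φ (α s) x) (φ s y) < ε}

/-- `M^s_{N,ε}(φ, Z)`: infimum of `Σ_i exp (-s t_i)` over countable families of
reparametrization balls `B(x_i, t_i, ε, φ)` with `t_i ≥ N` covering `Z`. -/
noncomputable def coverM [PseudoMetricSpace X] (φ : ℝ → X → X) (Z : Set X) (s : ℝ) (N : ℕ)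
    (ε : ℝ) : ℝ≥0∞ :=
  ⨅ (F : Set (X × ℝ)) (_ : F.Countable) (_ : ∀ p ∈ F, (N : ℝ) ≤ p.2)
    (_ : Z ⊆ ⋃ p ∈ F, reparBall φ p.1 p.2 ε),
    ∑' p : F, ENNReal.ofReal (Real.exp (-s * (p : X × ℝ).2))

/-- `M^s_ε(φ, Z) = lim_{N → ∞} M^s_{N,ε}(φ, Z)` (an increasing limit). -/
noncomputable def coverMeps [PseudoMetricSpace X] (φ : ℝ → X → X) (Z : Set X) (s ε : ℝ) :
    ℝ≥0∞ :=
  ⨆ N : ℕ, coverM φ Z s N ε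

/-- `M^s(φ, Z) = lim_{ε → 0} M^s_ε(φ, Z)` (an increasing limit as `ε` decreases). -/
noncomputable def coverMlim [PseudoMetricSpace X] (φ : ℝ → X → X) (Z : Set X) (s : ℝ) :
    ℝ≥0∞ :=
  ⨆ (ε : ℝ) (_ : 0 < ε), coverMeps φ Z s ε

/-- The Bowen entropy `h_top^B(φ, Z)`: the critical value where `M^s(φ,Z)` jumps
from `∞` to `0` (as an extended nonnegative real; `⊤` if no finite critical value). -/
noncomputable def bowenEntropy [PseudoMetricSpace X] (φ : ℝ → X → X) (Z : Set X) : ℝ≥0∞ :=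
  ⨅ (s : ℝ) (_ : 0 ≤ s) (_ : coverMlim φ Z s = 0), ENNReal.ofReal s

/-- Static entropy of a finite measurable partition, encoded as a map into a finite type. -/
noncomputable def partEnt [MeasurableSpace X] (μ : Measure X) {ι : Type*} [Fintype ι]
    (P : X → ι) : ℝ :=
  ∑ i : ι, Real.negMulLog ((μ (P ⁻¹' {i})).toReal)

/-- The measure-theoretic (Kolmogorov–Sinai) entropy of a map `T` with respect to `μ`:
the supremum over finite measurable partitions of the asymptotic entropy per unit time of
the dynamical refinements. -/
noncomputable def kolSinai [MeasurableSpace X] (μ : Measure X) (T : X → X) : ℝ≥0∞ :=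
  ⨆ (k : ℕ) (P : X → Fin k) (_ : Measurable P),
    Filter.limsup (fun n : ℕ =>
      ENNReal.ofReal (partEnt μ (fun x => fun j : Fin n => P (T^[(j : ℕ)] x)) / n))
      Filter.atTop

/-- `-log a` as a member of `ℝ≥0∞`, for `a ∈ [0,1]` (with `-log 0 = ∞`). -/
noncomputable def negLogNN (a : ℝ≥0∞) : ℝ≥0∞ :=
  if a = 0 then ⊤ else ENNReal.ofReal (-Real.log a.toReal)

/-- `-(1/t) log μ(B(x,t,ε,φ))`, as a member of `ℝ≥0∞`. -/
noncomputable def localRate [PseudoMetricSpace X] [MeasurableSpace X] (μ : Measure X)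
    (φ : ℝ → X → X) (x : X) (ε t : ℝ) : ℝ≥0∞ :=
  negLogNN (μ (reparBall φ x t ε)) / ENNReal.ofReal t

/-- The lower local entropy `underline h_μ(φ, x) = lim_{ε→0} liminf_{t→∞}
  -(1/t) log μ(B(x,t,ε,φ))` (the limit in `ε` is an increasing limit, hence a supremum). -/
noncomputable def lowerLocalEnt [PseudoMetricSpace X] [MeasurableSpace X] (μ : Measure X)
    (φ : ℝ → X → X) (x : X) : ℝ≥0∞ :=
  ⨆ (ε : ℝ) (_ : 0 < ε), Filter.liminf (fun t : ℝ => localRate μ φ x ε t) Filter.atTop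

/-- The upper local entropy `overline h_μ(φ, x) = lim_{ε→0} limsup_{t→∞}
  -(1/t) log μ(B(x,t,ε,φ))`. -/
noncomputable def upperLocalEnt [PseudoMetricSpace X] [MeasurableSpace X] (μ : Measure X)
    (φ : ℝ → X → X) (x : X) : ℝ≥0∞ :=
  ⨆ (ε : ℝ) (_ : 0 < ε), Filter.limsup (fun t : ℝ => localRate μ φ x ε t) Filter.atTop

/-- The set `G_μ(φ)` of generic points of `μ` for the flow `φ`. -/
def genericPts [TopologicalSpace X] [MeasurableSpace X] (φ : ℝ → X → X) (μ : Measure X) :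
    Set X :=
  {x : X | ∀ f : C(X, ℝ),
    Filter.Tendsto (fun t : ℝ => (1 / t) * ∫ τ in (0 : ℝ)..t, f (φ τ x))
      Filter.atTop (nhds (∫ y, f y ∂μ))}


section Renewal

variable {A : Type*} [Inhabited A]

/-- Extend a finite word to an infinite one by the default letter. -/
def wordExt {n : ℕ} (v : Fin n → A) : ℕ → A :=
  fun i => if h : i < n then v ⟨i, h⟩ else default

lemma wordExt_of_lt {n : ℕ} (v : Fin n → A) {i : ℕ} (h : i < n) :
    wordExt v i = v ⟨i, h⟩ := by
  simp [wordExt, h]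

/-- The weight of the first `N` letters of `ω`, summed over all ways of cutting them into
consecutive nonempty blocks; a block `v` of length `n` has weight `u n v`. -/
noncomputable def renewal {A : Type*} (u : ∀ n, (Fin n → A) → ℝ≥0∞) : ℕ → (ℕ → A) → ℝ≥0∞
  | 0, _ => 1
  | N + 1, ω => ∑ j : Fin (N + 1), u (j + 1) (fun i => ω i) *
      renewal u (N - j) (fun i => ω (i + (j + 1)))
termination_by N => N

lemma renewal_succ {A : Type*} (u : ∀ n, (Fin n → A) → ℝ≥0∞) (N : ℕ) (ω : ℕ → A) :
    renewal u (N + 1) ω = ∑ j ∈ Finset.range (N + 1), u (j + 1) (fun i => ω i) *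
      renewal u (N - j) (fun i => ω (i + (j + 1))) := by
  rw [renewal, Finset.sum_range]

lemma mul_renewal_le {A : Type*} (u : ∀ n, (Fin n → A) → ℝ≥0∞) {n N : ℕ} (hn : 1 ≤ n)
    (hN : n ≤ N) (ω : ℕ → A) :
    u n (fun i => ω i) * renewal u (N - n) (fun i => ω (i + n)) ≤ renewal u N ω := by
  obtain ⟨j, rfl⟩ := Nat.exists_eq_add_of_le' hn
  obtain ⟨N, rfl⟩ := Nat.exists_eq_add_of_le' (hn.trans hN)
  rw [renewal_succ, Nat.add_sub_add_right]
  exact Finset.single_le_sum (f := fun j => u (j + 1) (fun i => ω i) *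
      renewal u (N - j) (fun i => ω (i + (j + 1)))) (fun _ _ => zero_le)
    (Finset.mem_range.2 (by omega))

lemma renewal_congr {A : Type*} (u : ∀ n, (Fin n → A) → ℝ≥0∞) (N : ℕ) {ω ω' : ℕ → A}
    (h : ∀ i < N, ω i = ω' i) : renewal u N ω = renewal u N ω' := by
  induction N using Nat.strong_induction_on generalizing ω ω' with
  | _ N ih =>
    rcases N with _ | N
    · simp [renewal]
    · rw [renewal_succ, renewal_succ]
      refine Finset.sum_congr rfl fun j hj => ?_
      rw [Finset.mem_range] at hj
      congr 1
      · congr 1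
        funext i
        exact h i (by omega)
      · exact ih (N - j) (by omega) fun i hi => h _ (by omega)

lemma sum_mul_shift [Fintype A] (m n : ℕ) (F : (Fin m → A) → ℝ≥0∞) (G : (ℕ → A) → ℝ≥0∞) :
    ∑ v : Fin (m + n) → A, F (fun i => wordExt v i) * G (fun i => wordExt v (i + m)) =
      (∑ v, F v) * ∑ v : Fin n → A, G (wordExt v) := by
  rw [← (Fin.appendEquiv m n).sum_comp, Fintype.sum_prod_type, Finset.sum_mul_sum]
  refine Finset.sum_congr rfl fun a _ => Finset.sum_congr rfl fun b _ => ?_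
  congr 2
  · funext i
    rw [wordExt_of_lt _ (by omega)]
    exact Fin.append_left a b i
  · funext i
    by_cases hi : i < n
    · rw [wordExt_of_lt _ (by omega), wordExt_of_lt _ hi]
      have : (⟨i + m, by omega⟩ : Fin (m + n)) = Fin.natAdd m ⟨i, hi⟩ := by
        ext; simp [add_comm]
      rw [this]
      exact Fin.append_right a b _
    · simp only [wordExt, hi, dite_false]
      rw [dif_neg (by omega)]

lemma sum_renewal_le_one [Fintype A] (u : ∀ n, (Fin n → A) → ℝ≥0∞)
    (hu : ∀ N, ∑ j ∈ Finset.range N, ∑ v, u (j + 1) v ≤ 1) (N : ℕ) :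
    ∑ v : Fin N → A, renewal u N (wordExt v) ≤ 1 := by
  induction N using Nat.strong_induction_on with
  | _ N ih =>
    rcases N with _ | N
    · simp [renewal]
    · simp_rw [renewal_succ]
      rw [Finset.sum_comm]
      refine le_trans (Finset.sum_le_sum fun j hj => ?_) (hu (N + 1))
      rw [Finset.mem_range] at hj
      obtain ⟨n, rfl⟩ : ∃ n, N = j + n := Nat.exists_eq_add_of_le (by omega)
      have hlen : j + n + 1 = (j + 1) + n := by omega
      have hsub : j + n - j = n := by omega
      rw [hlen, hsub, sum_mul_shift (j + 1) n (u (j + 1)) (renewal u n)]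
      exact mul_le_of_le_one_right' (ih n (by omega))

/-- Greedy parsing of the itinerary of `x` into blocks of controlled weight. -/
lemma exp_le_renewal {A : Type*} {T : X → X} {P : X → A} {u : ∀ n, (Fin n → A) → ℝ≥0∞}
    {f : X → ℝ} (hf : ∀ x, 0 ≤ f x) {C : ℝ} (hC : 0 ≤ C) {N₀ : ℕ}
    (hu1 : ∀ v, ENNReal.ofReal (Real.exp (-C)) ≤ u 1 v) (N : ℕ) {x : X}
    (h : ∀ l, ∃ n, 1 ≤ n ∧ n ≤ N₀ ∧
      ENNReal.ofReal (Real.exp (-∑ i ∈ Finset.range n, f (T^[i] (T^[l] x)))) ≤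
        u n (fun i => P (T^[i] (T^[l] x)))) :
    ENNReal.ofReal (Real.exp (-(∑ i ∈ Finset.range N, f (T^[i] x) + C * N₀))) ≤
      renewal u N (fun i => P (T^[i] x)) := by
  have hshort : ∀ N : ℕ, ∀ ω : ℕ → A, ENNReal.ofReal (Real.exp (-(C * N))) ≤ renewal u N ω := by
    intro N
    induction N with
    | zero => intro ω; simp [renewal]
    | succ N ih =>
      intro ω
      refine le_trans ?_ (mul_renewal_le u le_rfl (by omega) ω)
      refine le_trans (le_of_eq ?_) (mul_le_mul' (hu1 _) (ih _))
      rw [← ENNReal.ofReal_mul (Real.exp_pos _).le, ← Real.exp_add]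
      congr 2
      push_cast
      ring
  induction N using Nat.strong_induction_on generalizing x with
  | _ N ih =>
    obtain ⟨n, hn1, hn, hle⟩ := h 0
    simp only [Function.iterate_zero, id] at hle
    by_cases hnN : n ≤ N
    · refine le_trans ?_ (mul_renewal_le u hn1 hnN _)
      have := ih (N - n) (by omega) (x := T^[n] x) fun l => by
        simpa only [← Function.iterate_add_apply] using h (l + n)
      simp only [← Function.iterate_add_apply] at this
      refine le_trans (le_of_eq ?_) (mul_le_mul' hle this)
      rw [← ENNReal.ofReal_mul (Real.exp_pos _).le, ← Real.exp_add]
      congr 2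
      obtain ⟨m, rfl⟩ := Nat.exists_eq_add_of_le hnN
      rw [Finset.sum_range_add, Nat.add_sub_cancel_left]
      simp only [add_comm n]
      ring
    · refine le_trans (ENNReal.ofReal_le_ofReal (Real.exp_le_exp.2 ?_)) (hshort N _)
      have h1 : 0 ≤ ∑ i ∈ Finset.range N, f (T^[i] x) := Finset.sum_nonneg fun _ _ => hf _
      have h2 : C * N ≤ C * N₀ := mul_le_mul_of_nonneg_left (by exact_mod_cast (by omega)) hC
      linarith

end Renewal

section Entropy

variable [MeasurableSpace X]

/-- The Gibbs inequality: a sub-probability vector bounds the entropy of a partition. -/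
lemma partEnt_le_integral {μ : Measure X} [IsProbabilityMeasure μ] {ι : Type*} [Fintype ι]
    {Z : X → ι} (hZ : ∀ i, MeasurableSet (Z ⁻¹' {i})) {q : ι → ℝ≥0∞} (hq : ∑ i, q i ≤ 1)
    {G : X → ℝ} (hG : Integrable G μ)
    (h : ∀ᵐ x ∂μ, ENNReal.ofReal (Real.exp (-G x)) ≤ q (Z x)) :
    partEnt μ Z ≤ ∫ x, G x ∂μ := by
  have hqtop : ∀ i, q i ≠ ⊤ := fun i =>
    ne_top_of_le_ne_top ENNReal.one_ne_top
      ((Finset.single_le_sum (f := q) (fun _ _ => zero_le) (Finset.mem_univ i)).trans hq)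
  have hunion : (⋃ i, Z ⁻¹' {i}) = univ := by ext x; simp
  have hdisj : Pairwise (Function.onFun Disjoint fun i => Z ⁻¹' {i}) := fun i j hij =>
    Disjoint.preimage _ (by simpa using hij)
  have hsum : ∫ x, G x ∂μ = ∑ i, ∫ x in Z ⁻¹' {i}, G x ∂μ := by
    rw [← integral_iUnion_fintype hZ hdisj (fun i => hG.integrableOn), hunion, setIntegral_univ]
  have hp : ∑ i, μ.real (Z ⁻¹' {i}) = 1 := by
    rw [← measureReal_iUnion_fintype hdisj hZ, hunion, probReal_univ]
  have hq' : ∑ i, (q i).toReal ≤ 1 := by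
    rw [← ENNReal.toReal_sum fun i _ => hqtop i]
    exact ENNReal.toReal_le_of_le_ofReal zero_le_one (by simpa using hq)
  have key : ∀ i, Real.negMulLog (μ.real (Z ⁻¹' {i})) ≤
      ∫ x in Z ⁻¹' {i}, G x ∂μ + ((q i).toReal - μ.real (Z ⁻¹' {i})) := by
    intro i
    rcases eq_or_ne (μ (Z ⁻¹' {i})) 0 with h0 | h0
    · have : μ.real (Z ⁻¹' {i}) = 0 := by simp [measureReal_def, h0]
      rw [this, Measure.restrict_eq_zero.2 h0]
      simp
    have hppos : 0 < μ.real (Z ⁻¹' {i}) := ENNReal.toReal_pos h0 (measure_ne_top _ _)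
    have hae : ∀ᵐ x ∂μ.restrict (Z ⁻¹' {i}), ENNReal.ofReal (Real.exp (-G x)) ≤ q i := by
      rw [ae_restrict_iff' (hZ i)]
      filter_upwards [h] with x hx hxi
      rwa [show Z x = i from hxi] at hx
    have hne : NeBot (ae (μ.restrict (Z ⁻¹' {i}))) := by
      rw [ae_neBot]
      simpa using h0
    have hqpos : 0 < (q i).toReal := by
      obtain ⟨x, hx⟩ := hae.exists
      exact ENNReal.toReal_pos
        (ne_of_gt (lt_of_lt_of_le (ENNReal.ofReal_pos.2 (Real.exp_pos _)) hx)) (hqtop i)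
    have hlow : μ.real (Z ⁻¹' {i}) * (-Real.log (q i).toReal) ≤
        ∫ x in Z ⁻¹' {i}, G x ∂μ := by
      have := integral_mono_ae (μ := μ.restrict (Z ⁻¹' {i}))
        (f := fun _ => -Real.log (q i).toReal) (g := G) (integrable_const _)
        hG.integrableOn (by
          filter_upwards [hae] with x hx
          have : Real.exp (-G x) ≤ (q i).toReal := (ENNReal.ofReal_le_iff_le_toReal (hqtop i)).1 hx
          have := (Real.le_log_iff_exp_le hqpos).2 this
          linarith)
      simpa using this
    refine le_trans ?_ (add_le_add_left hlow _)
    have hlog := Real.log_le_sub_one_of_pos (div_pos hqpos hppos)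
    rw [Real.log_div hqpos.ne' hppos.ne'] at hlog
    have := mul_le_mul_of_nonneg_left hlog hppos.le
    rw [mul_sub, mul_sub, mul_div_cancel₀ _ hppos.ne'] at this
    rw [Real.negMulLog]
    linarith
  calc partEnt μ Z ≤ ∑ i, (∫ x in Z ⁻¹' {i}, G x ∂μ + ((q i).toReal - μ.real (Z ⁻¹' {i}))) :=
        Finset.sum_le_sum fun i _ => key i
    _ ≤ ∫ x, G x ∂μ := by
        rw [Finset.sum_add_distrib, Finset.sum_sub_distrib, ← hsum, hp]
        linarith

lemma limsup_partEnt_le {μ : Measure X} [IsProbabilityMeasure μ] {A : Type*} [Fintype A]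
    [Inhabited A] [MeasurableSpace A] [MeasurableSingletonClass A] {T : X → X}
    (hT : MeasurePreserving T μ μ) {P : X → A} (hP : Measurable P)
    {u : ∀ n, (Fin n → A) → ℝ≥0∞} (hu : ∀ N, ∑ j ∈ Finset.range N, ∑ v, u (j + 1) v ≤ 1)
    {f : X → ℝ} (hf : ∀ x, 0 ≤ f x) (hfi : Integrable f μ) {C : ℝ} (hC : 0 ≤ C) {N₀ : ℕ}
    (hu1 : ∀ v, ENNReal.ofReal (Real.exp (-C)) ≤ u 1 v)
    (h : ∀ᵐ x ∂μ, ∃ n, 1 ≤ n ∧ n ≤ N₀ ∧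
      ENNReal.ofReal (Real.exp (-∑ i ∈ Finset.range n, f (T^[i] x))) ≤
        u n (fun i => P (T^[i] x))) :
    limsup (fun n : ℕ =>
      ENNReal.ofReal (partEnt μ (fun x => fun j : Fin n => P (T^[(j : ℕ)] x)) / n)) atTop ≤
      ENNReal.ofReal (∫ x, f x ∂μ) := by
  have hiter : ∀ᵐ x ∂μ, ∀ l, ∃ n, 1 ≤ n ∧ n ≤ N₀ ∧
      ENNReal.ofReal (Real.exp (-∑ i ∈ Finset.range n, f (T^[i] (T^[l] x)))) ≤
        u n (fun i => P (T^[i] (T^[l] x))) :=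
    ae_all_iff.2 fun l => (hT.iterate l).quasiMeasurePreserving.ae h
  have hfint : ∀ i, Integrable (fun x => f (T^[i] x)) μ := fun i =>
    (hT.iterate i).integrable_comp_of_integrable hfi
  have hbound : ∀ N : ℕ, partEnt μ (fun x => fun j : Fin N => P (T^[(j : ℕ)] x)) ≤
      N * ∫ x, f x ∂μ + C * N₀ := by
    intro N
    have hint : Integrable (fun x => ∑ i ∈ Finset.range N, f (T^[i] x) + C * N₀) μ :=
      (integrable_finsetSum _ fun i _ => hfint i).add (integrable_const _)
    have hmeas : Measurable (fun x => fun j : Fin N => P (T^[(j : ℕ)] x)) :=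
      measurable_pi_lambda _ fun j => hP.comp (hT.iterate j).measurable
    refine (partEnt_le_integral (fun i => hmeas (measurableSet_singleton i))
      (sum_renewal_le_one u hu N) hint ?_).trans (le_of_eq ?_)
    · filter_upwards [hiter] with x hx
      refine (exp_le_renewal hf hC hu1 N hx).trans (le_of_eq (renewal_congr u N fun i hi => ?_))
      rw [wordExt_of_lt _ hi]
    · rw [integral_add (integrable_finsetSum _ fun i _ => hfint i) (integrable_const _),
        integral_finsetSum _ fun i _ => hfint i]
      have : ∀ i, ∫ x, f (T^[i] x) ∂μ = ∫ x, f x ∂μ := fun i => by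
        have hi := hT.iterate i
        rw [← integral_map hi.measurable.aemeasurable (by rw [hi.map_eq]; exact hfi.1), hi.map_eq]
      simp [this]
  have hlim : Tendsto (fun n : ℕ => ENNReal.ofReal (∫ x, f x ∂μ + C * N₀ / n)) atTop
      (𝓝 (ENNReal.ofReal (∫ x, f x ∂μ))) := by
    refine ENNReal.tendsto_ofReal ?_
    simpa using tendsto_const_nhds.add (tendsto_const_div_atTop_nhds_zero_nat (C * N₀))
  refine (limsup_le_limsup ?_).trans hlim.limsup_eq.le
  filter_upwards [eventually_gt_atTop 0] with n hn
  have hn' : (0 : ℝ) < n := by exact_mod_cast hn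
  refine ENNReal.ofReal_le_ofReal ?_
  rw [div_le_iff₀ hn', add_mul, div_mul_cancel₀ _ hn'.ne']
  linarith [hbound n]

end Entropy

section NoisyCode

variable [MeasurableSpace X] {A E : Type*}

/-- The weight of a word `v` when a `μ`-random point `y` and a uniformly random choice `e` of
sampling maps `S e` are drawn, and the letters are read with densities `ν · (S e i y)`. -/
noncomputable def noisyCode [Fintype E] (μ : Measure X) (ν : A → X → ℝ≥0∞) (S : E → ℕ → X → X)
    {n : ℕ} (v : Fin n → A) : ℝ≥0∞ :=
  ∫⁻ y, ∑ e : E, (Fintype.card E : ℝ≥0∞)⁻¹ * ∏ i : Fin n, ν (v i) (S e i y) ∂μ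

lemma measurable_noisyCode_integrand [Fintype E] {ν : A → X → ℝ≥0∞} (hν : ∀ a, Measurable (ν a))
    {S : E → ℕ → X → X} (hS : ∀ e i, Measurable (S e i)) {n : ℕ} (v : Fin n → A) :
    Measurable fun y => ∑ e : E, (Fintype.card E : ℝ≥0∞)⁻¹ * ∏ i : Fin n, ν (v i) (S e i y) :=
  Finset.measurable_fun_sum _ fun e _ => Measurable.const_mul (Finset.measurable_fun_prod
    (f := fun (i : Fin n) y => ν (v i) (S e i y)) _ fun i _ => (hν (v i)).comp (hS e i)) _

lemma sum_noisyCode_le_one [Fintype E] [Nonempty E] [Fintype A] {μ : Measure X}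
    [IsProbabilityMeasure μ] {ν : A → X → ℝ≥0∞} (hν : ∀ a, Measurable (ν a))
    (hν1 : ∀ x, ∑ a, ν a x ≤ 1) {S : E → ℕ → X → X} (hS : ∀ e i, Measurable (S e i)) (n : ℕ) :
    ∑ v : Fin n → A, noisyCode μ ν S v ≤ 1 := by
  classical
  simp only [noisyCode]
  rw [← lintegral_finsetSum _ fun v _ => measurable_noisyCode_integrand hν hS v]
  calc _ ≤ ∫⁻ _, 1 ∂μ := lintegral_mono fun y => ?_
    _ = 1 := by simp
  simp only
  rw [Finset.sum_comm]
  calc _ ≤ ∑ _e : E, (Fintype.card E : ℝ≥0∞)⁻¹ := Finset.sum_le_sum fun e _ => by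
        rw [← Finset.mul_sum, ← Fintype.prod_sum (fun (i : Fin n) a => ν a (S e i y))]
        exact mul_le_of_le_one_right' (Finset.prod_le_one' fun i _ => hν1 _)
    _ ≤ 1 := by
        rw [Finset.sum_const, Finset.card_univ, nsmul_eq_mul]
        exact ENNReal.mul_inv_le_one _

lemma mul_measure_le_noisyCode [Fintype E] {μ : Measure X} {ν : A → X → ℝ≥0∞}
    (hν : ∀ a, Measurable (ν a)) {S : E → ℕ → X → X} (hS : ∀ e i, Measurable (S e i))
    {n : ℕ} {v : Fin n → A} {B : Set X} {c : ℝ≥0∞}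
    (hB : ∀ y ∈ B, ∃ e, c ≤ ∏ i : Fin n, ν (v i) (S e i y)) :
    (Fintype.card E : ℝ≥0∞)⁻¹ * c * μ B ≤ noisyCode μ ν S v := by
  refine le_trans ?_ (mul_meas_ge_le_lintegral (measurable_noisyCode_integrand hν hS v)
    ((Fintype.card E : ℝ≥0∞)⁻¹ * c))
  gcongr
  intro y hy
  obtain ⟨e, he⟩ := hB y hy
  refine le_trans (mul_le_mul_right he _) ?_
  exact Finset.single_le_sum
    (f := fun e => (Fintype.card E : ℝ≥0∞)⁻¹ * ∏ i : Fin n, ν (v i) (S e i y))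
    (fun _ _ => zero_le) (Finset.mem_univ e)

end NoisyCode

section Flow

variable {φ : ℝ → X → X}

lemma IsFlow.iterate [TopologicalSpace X] (hφ : IsFlow φ) (τ : ℝ) (n : ℕ) (x : X) :
    (φ τ)^[n] x = φ (n * τ) x := by
  induction n with
  | zero => simp [hφ.map_zero]
  | succ n ih =>
    rw [Function.iterate_succ_apply', ih, ← hφ.map_add]
    congr 1
    push_cast
    ring

lemma IsFlow.continuous_apply [TopologicalSpace X] (hφ : IsFlow φ) (t : ℝ) :
    Continuous (φ t) :=
  hφ.cont.comp (Continuous.prodMk_right t)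

/-- Small positive times move every point, uniformly. -/
lemma IsFlow.eventually_ne [MetricSpace X] [CompactSpace X] (hφ : IsFlow φ)
    (hfp : FixedPointFree φ) : ∀ᶠ c in 𝓝 (0 : ℝ), ∀ z, 0 < c → φ c z ≠ z := by
  suffices ∀ᶠ c in 𝓝 (0 : ℝ), ∀ z ∈ (univ : Set X), 0 < c → φ c z ≠ z by simpa using this
  refine isCompact_univ.eventually_forall_of_forall_eventually fun x _ => ?_
  obtain ⟨t, ht⟩ := hfp x
  have hcont : Continuous fun p : ℝ × X => φ p.1 p.2 := hφ.cont
  have hopen : IsOpen {p : ℝ × X | φ p.1 p.2 ≠ p.2} := isOpen_ne_fun hcont continuous_snd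
  have hmem : ({p : ℝ × X | φ p.1 p.2 ≠ p.2}) ∈ 𝓝 (t, x) := hopen.mem_nhds ht
  rw [nhds_prod_eq, Filter.mem_prod_iff] at hmem
  obtain ⟨U, hU, V, hV, hUV⟩ := hmem
  obtain ⟨r, hr, hrU⟩ := Metric.mem_nhds_iff.1 hU
  rw [nhds_prod_eq]
  refine Filter.mem_of_superset (prod_mem_prod (Metric.ball_mem_nhds 0 hr) hV) ?_
  rintro ⟨c, z⟩ ⟨hc, hz⟩ hc0 hfix
  simp only at hc hz hc0 hfix
  have hint : ∀ n : ℤ, φ (n * c) z = z := by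
    intro n
    induction n using Int.induction_on with
    | zero => simp [hφ.map_zero]
    | succ n ih =>
      rw [show ((n + 1 : ℤ) : ℝ) * c = (n : ℤ) * c + c by push_cast; ring, hφ.map_add, hfix, ih]
    | pred n ih =>
      have h1 : φ (-c) z = z := by
        have h2 := hφ.map_add (-c) c z
        rw [hfix, neg_add_cancel, hφ.map_zero] at h2
        exact h2.symm
      rw [show ((-n - 1 : ℤ) : ℝ) * c = (-n : ℤ) * c + -c by push_cast; ring, hφ.map_add, h1, ih]
  have habs : c < r := by
    have := Metric.mem_ball.1 hc
    rw [Real.dist_eq, sub_zero] at this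
    exact (le_abs_self c).trans_lt this
  refine hUV (a := ((⌊t / c⌋ : ℝ) * c, z)) ⟨hrU ?_, hz⟩ (hint _)
  rw [Metric.mem_ball, Real.dist_eq, abs_lt]
  have h1 := Int.floor_le (t / c)
  have h2 := Int.lt_floor_add_one (t / c)
  rw [le_div_iff₀ hc0] at h1
  rw [div_lt_iff₀ hc0] at h2
  constructor <;> nlinarith

/-- Uniform continuity of the flow over bounded times. -/
lemma IsFlow.exists_dist_lt [MetricSpace X] [CompactSpace X] (hφ : IsFlow φ) (R : ℝ) {η : ℝ}
    (hη : 0 < η) : ∃ ε > 0, ∀ u ∈ Icc (-R) R, ∀ u' ∈ Icc (-R) R, ∀ z w, |u - u'| < ε →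
      dist z w < ε → dist (φ u z) (φ u' w) < η := by
  have huc := (isCompact_Icc.prod isCompact_univ : IsCompact (Icc (-R) R ×ˢ (univ : Set X)))
    |>.uniformContinuousOn_of_continuous hφ.cont.continuousOn
  obtain ⟨ε, hε, h⟩ := Metric.uniformContinuousOn_iff.1 huc η hη
  refine ⟨ε, hε, fun u hu u' hu' z w huu hzw => h (u, z) ⟨hu, trivial⟩ (u', w) ⟨hu', trivial⟩ ?_⟩
  rw [Prod.dist_eq, max_lt_iff]
  exact ⟨huu, hzw⟩

/-- If `s ↦ φ (α s) x` closely follows the orbit of `y`, then `α` advances at almost unit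
speed. -/
lemma IsFlow.exists_drift_le [MetricSpace X] [CompactSpace X] (hφ : IsFlow φ) {c : ℝ}
    (hc : 0 < c) (hper : ∀ z, φ c z ≠ z) {R : ℝ} (hR : 0 ≤ R) :
    ∃ ε > 0, ∀ (x y : X) (t : ℝ) (α : ℝ → ℝ), Continuous α →
      (∀ s ∈ Icc 0 t, dist (φ (α s) x) (φ s y) < ε) →
      ∀ s s', 0 ≤ s → s ≤ s' → s' ≤ t → s' ≤ s + R → |α s' - α s - (s' - s)| ≤ c := by
  have hper' : ∀ u z, φ (u + c) z ≠ φ u z := fun u z h => hper (φ u z) <| by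
    rw [← hφ.map_add, add_comm, h]
  have hcomp : IsCompact (Icc (-(R + c)) (R + c) ×ˢ (univ : Set X)) :=
    isCompact_Icc.prod isCompact_univ
  have hcont : Continuous fun p : ℝ × X => dist (φ (p.1 + c) p.2) (φ p.1 p.2) :=
    (hφ.cont.comp (f := fun p : ℝ × X => (p.1 + c, p.2)) (by fun_prop)).dist hφ.cont
  obtain ⟨η, hη, hsep⟩ := hcomp.exists_forall_le' (a := 0) hcont.continuousOn
    fun p _ => dist_pos.2 (hper' p.1 p.2)
  obtain ⟨ε, hε, hunif⟩ := hφ.exists_dist_lt R (half_pos hη)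
  obtain ⟨ε', hε', hεη⟩ : ∃ ε' > 0, ε' ≤ ε ∧ ε' ≤ η / 2 :=
    ⟨min ε (η / 2), lt_min hε (half_pos hη), min_le_left _ _, min_le_right _ _⟩
  refine ⟨ε', hε', fun x y t α hα hclose s s' hs hss hst hsR => ?_⟩
  by_contra! hbig
  have hivt : c ∈ (fun r => |α r - α s - (r - s)|) '' Icc s s' :=
    intermediate_value_Icc hss (by fun_prop) ⟨by simpa using hc.le, hbig.le⟩
  obtain ⟨r, ⟨hr1, hr2⟩, hrc⟩ := hivt
  simp only at hrc
  have hx : φ (α r) x = φ (α r - α s) (φ (α s) x) := by rw [← hφ.map_add]; congr 1; ring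
  have hy : φ r y = φ (r - s) (φ s y) := by rw [← hφ.map_add]; congr 1; ring
  have hmem : r - s ∈ Icc (-R) R := ⟨by linarith, by linarith⟩
  have h1 := hclose r ⟨by linarith, by linarith⟩
  have h2 := hunif (r - s) hmem (r - s) hmem (φ (α s) x) (φ s y) (by simpa using hε)
    ((hclose s ⟨hs, by linarith⟩).trans_le hεη.1)
  rw [← hy] at h2
  have h3 : dist (φ (α r) x) (φ (r - s) (φ (α s) x)) < η := by
    have := dist_triangle_right (φ (α r) x) (φ (r - s) (φ (α s) x)) (φ r y)
    linarith [hεη.2]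
  rw [hx] at h3
  rcases (abs_eq hc.le).1 hrc with h | h
  · have := hsep (r - s, φ (α s) x) ⟨⟨by simp only; linarith, by simp only; linarith⟩, trivial⟩
    simp only at this
    rw [show r - s + c = α r - α s by linarith] at this
    linarith
  · have := hsep (r - s - c, φ (α s) x)
      ⟨⟨by simp only; linarith, by simp only; linarith⟩, trivial⟩
    simp only at this
    rw [sub_add_cancel, dist_comm, show r - s - c = α r - α s by linarith] at this
    linarith

end Flow

section Tracking

/-- The starting index of block `j` when consecutive blocks are `N`, `N + 1` or `N + 2` apart,
as prescribed by `e`. -/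
def blockStart (N : ℕ) (e : ℕ → Fin 3) (j : ℕ) : ℕ :=
  ∑ l ∈ Finset.range j, (N + (e l : ℕ))

lemma blockStart_succ (N : ℕ) (e : ℕ → Fin 3) (j : ℕ) :
    blockStart N e (j + 1) = blockStart N e j + (N + (e j : ℕ)) :=
  Finset.sum_range_succ _ _

lemma blockStart_congr (N : ℕ) {e e' : ℕ → Fin 3} {j : ℕ} (h : ∀ l < j, e l = e' l) :
    blockStart N e j = blockStart N e' j :=
  Finset.sum_congr rfl fun l hl => by rw [h l (Finset.mem_range.1 hl)]

lemma blockStart_le (N : ℕ) (e : ℕ → Fin 3) (j : ℕ) : blockStart N e j ≤ j * (N + 2) := by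
  induction j with
  | zero => simp [blockStart]
  | succ j ih =>
    rw [blockStart_succ, Nat.succ_mul]
    have := (e j).isLt
    omega

/-- A path of almost unit speed is followed by blocks of unit speed, starting at multiples of `κ`
and corrected by at most one unit `κ` at the end of each block. -/
lemma exists_blockStart_near {κ : ℝ} {N b : ℕ} {t : ℝ} {α : ℝ → ℝ} (hκ : 0 < κ) (hα : α 0 = 0)
    (hdrift : ∀ s s', 0 ≤ s → s ≤ s' → s' ≤ t → s' ≤ s + (N + 2) * κ →
      |α s' - α s - (s' - s)| ≤ κ / 2) (hb : b * (N + 2) * κ ≤ t) :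
    ∃ e : ℕ → Fin 3, ∀ j ≤ b, |α (blockStart N e j * κ) - j * (N + 1) * κ| ≤ κ := by
  induction b with
  | zero =>
    refine ⟨0, fun j hj => ?_⟩
    obtain rfl : j = 0 := by omega
    simpa [blockStart, hα] using hκ.le
  | succ b ih =>
    push_cast at hb
    have hNκ : 0 ≤ (N + 2) * κ := by positivity
    obtain ⟨e, he⟩ := ih (by nlinarith)
    have hstart : (blockStart N e b : ℝ) ≤ b * (N + 2) := by exact_mod_cast blockStart_le N e b
    have hstart' : blockStart N e b * κ ≤ b * (N + 2) * κ :=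
      mul_le_mul_of_nonneg_right hstart hκ.le
    have hstep : ∀ d : Fin 3,
        |α ((blockStart N e b + (N + (d : ℕ))) * κ) - α (blockStart N e b * κ) - (N + (d : ℕ)) * κ|
          ≤ κ / 2 := by
      intro d
      have hd : ((d : ℕ) : ℝ) ≤ 2 := by exact_mod_cast (by omega : (d : ℕ) ≤ 2)
      have hdκ : (N + (d : ℕ)) * κ ≤ (N + 2) * κ := by gcongr
      have h0 : 0 ≤ (N + (d : ℕ)) * κ := by positivity
      have := hdrift (blockStart N e b * κ) ((blockStart N e b + (N + (d : ℕ))) * κ)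
        (by positivity) (by linarith) (by linarith) (by linarith)
      rwa [show (blockStart N e b + (N + (d : ℕ))) * κ - blockStart N e b * κ =
        (N + (d : ℕ)) * κ by ring] at this
    have hprev := abs_le.1 (he b le_rfl)
    obtain ⟨d, hd⟩ : ∃ d : Fin 3, |α ((blockStart N e b + (N + (d : ℕ))) * κ) -
        (b + 1) * (N + 1) * κ| ≤ κ := by
      have s0 := abs_le.1 (hstep 0)
      have s1 := abs_le.1 (hstep 1)
      have s2 := abs_le.1 (hstep 2)
      simp only [Fin.val_zero, Fin.val_one, Fin.val_two, Nat.cast_zero, Nat.cast_one,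
        Nat.cast_ofNat] at s0 s1 s2
      by_cases h1 : α ((blockStart N e b + (N + 1)) * κ) - (b + 1) * (N + 1) * κ ≤ κ
      · by_cases h2 : -κ ≤ α ((blockStart N e b + (N + 1)) * κ) - (b + 1) * (N + 1) * κ
        · exact ⟨1, by simpa using abs_le.2 ⟨h2, h1⟩⟩
        · refine ⟨2, ?_⟩
          simp only [Fin.val_two, Nat.cast_ofNat]
          rw [abs_le]
          constructor <;> nlinarith
      · refine ⟨0, ?_⟩
        simp only [Fin.val_zero, Nat.cast_zero]
        rw [abs_le]
        constructor <;> nlinarith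
    refine ⟨Function.update e b d, fun j hj => ?_⟩
    rcases Nat.lt_or_ge b j with hjb | hjb
    · obtain rfl : j = b + 1 := by omega
      rw [blockStart_succ, blockStart_congr N (e' := e)
        fun l hl => Function.update_of_ne (by omega) _ _]
      simpa using hd
    · rw [blockStart_congr N (e' := e) fun l hl => Function.update_of_ne (by omega) _ _]
      exact he j hjb

/-- The ball of points `y` whose orbit up to time `t` is followed within `ε` by a
time-changed orbit of `x`, the time change being continuous but not necessarily injective. -/
def tracingBall [PseudoMetricSpace X] (φ : ℝ → X → X) (x : X) (t ε : ℝ) : Set X :=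
  {y : X | ∃ α : ℝ → ℝ, Continuous α ∧ α 0 = 0 ∧
      ∀ s ∈ Set.Icc (0 : ℝ) t, dist (φ (α s) x) (φ s y) < ε}

/-- The sampling times in the orbit of a point traced by `x`: within each block of length `M`
the orbit is sampled with period `L * κ`. -/
noncomputable def sampleTime (M L : ℕ) (κ : ℝ) (e : ℕ → Fin 3) (i : ℕ) : ℝ :=
  (blockStart (M * L - 1) e (i / M) + (i % M : ℕ) * L) * κ

variable {φ : ℝ → X → X}

lemma IsFlow.exists_sampleTime [MetricSpace X] [CompactSpace X] (hφ : IsFlow φ)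
    (hfp : FixedPointFree φ) {τ : ℝ} (hτ : 0 < τ) {ρ : ℝ} (hρ : 0 < ρ) {M : ℕ} (hM : 1 ≤ M) :
    ∃ ε > 0, ∃ (L : ℕ) (κ : ℝ), ∀ (N : ℕ) (x y : X), y ∈ tracingBall φ x (N * τ) ε →
      ∃ e : ℕ → Fin 3, ∀ i < N / (M + 1) * M,
        dist (φ (i * τ) x) (φ (sampleTime M L κ e i) y) < ρ := by
  obtain ⟨ε₁, hε₁, hmove⟩ := hφ.exists_dist_lt 1 (half_pos hρ)
  obtain ⟨r, hr, hper⟩ := Metric.eventually_nhds_iff.1 (hφ.eventually_ne hfp)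
  obtain ⟨L, hL⟩ := exists_nat_gt (max (τ / r) (max (2 * τ / ε₁) (2 * τ)))
  have hL0 : (0 : ℝ) < L := lt_of_le_of_lt (by positivity) hL
  have hL1 : 1 ≤ L := by exact_mod_cast hL0
  simp only [max_lt_iff] at hL
  obtain ⟨κ, hκτ⟩ : ∃ κ, κ = τ / L := ⟨_, rfl⟩
  have hκ : 0 < κ := hκτ ▸ div_pos hτ hL0
  have hLκ : L * κ = τ := by rw [hκτ]; field_simp
  have hκr : κ < r := by
    rw [hκτ, div_lt_iff₀ hL0]; have := (div_lt_iff₀ hr).1 hL.1; linarith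
  have hκε : 2 * κ < ε₁ := by
    rw [hκτ, ← mul_div_assoc, div_lt_iff₀ hL0]; have := (div_lt_iff₀ hε₁).1 hL.2.1; linarith
  have hκ1 : 2 * κ < 1 := by
    rw [hκτ, ← mul_div_assoc, div_lt_iff₀ hL0]; linarith [hL.2.2]
  have hκper : ∀ z, φ (κ / 2) z ≠ z := fun z =>
    hper (y := κ / 2) (by rw [Real.dist_eq, sub_zero, abs_of_pos (by positivity)]; linarith) z
      (by positivity)
  obtain ⟨ε₂, hε₂, hdrift⟩ := hφ.exists_drift_le (half_pos hκ) hκper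
    (R := (M * L + 1) * κ) (by positivity)
  refine ⟨min ε₂ (ρ / 2), lt_min hε₂ (half_pos hρ), L, κ, ?_⟩
  rintro N x y ⟨α, hα, hα0, hclose⟩
  have hML : 1 ≤ M * L := Nat.one_le_iff_ne_zero.2 (by positivity)
  have hcast : ((M * L - 1 : ℕ) : ℝ) = M * L - 1 := by push_cast [Nat.cast_sub hML]; ring
  have hd := hdrift x y (N * τ) α hα fun s hs => (hclose s hs).trans_le (min_le_left _ _)
  have hbN : (N / (M + 1) : ℕ) * (M * L + 1) * κ ≤ N * τ := by
    have h1 : N / (M + 1) * (M * L + 1) ≤ N * L := by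
      calc N / (M + 1) * (M * L + 1) ≤ N / (M + 1) * ((M + 1) * L) := by
            gcongr; rw [Nat.succ_mul]; omega
        _ = N / (M + 1) * (M + 1) * L := by ring
        _ ≤ N * L := by gcongr; exact Nat.div_mul_le_self _ _
    have h2 : ((N / (M + 1) : ℕ) * (M * L + 1) : ℝ) ≤ N * L := by exact_mod_cast h1
    rw [← hLκ, ← mul_assoc]
    exact mul_le_mul_of_nonneg_right h2 hκ.le
  obtain ⟨e, he⟩ := exists_blockStart_near (N := M * L - 1) (b := N / (M + 1)) (t := N * τ) hκ hα0
    (by rw [hcast]; intro s s' h1 h2 h3 h4; exact hd s s' h1 h2 h3 (by linarith))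
    (by rw [hcast]; convert hbN using 2; ring)
  refine ⟨e, fun i hi => ?_⟩
  have hj : i / M < N / (M + 1) := by rwa [Nat.div_lt_iff_lt_mul hM]
  have hi' : ((i / M : ℕ) : ℝ) * M + (i % M : ℕ) = i := by exact_mod_cast Nat.div_add_mod' i M
  have hmod : ((i % M : ℕ) : ℝ) ≤ M := by exact_mod_cast (Nat.mod_lt i hM).le
  have hnear := abs_le.1 (he (i / M) hj.le)
  rw [hcast] at hnear
  have hstart := blockStart_le (M * L - 1) e (i / M)
  have hstart' : (blockStart (M * L - 1) e (i / M) : ℝ) ≤ (i / M : ℕ) * (M * L + 1) := by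
    have : M * L - 1 + 2 = M * L + 1 := by omega
    rw [this] at hstart
    exact_mod_cast hstart
  have hj' : ((i / M : ℕ) : ℝ) + 1 ≤ (N / (M + 1) : ℕ) := by exact_mod_cast hj
  set m : ℝ := (blockStart (M * L - 1) e (i / M) : ℝ) with hm
  set q : ℝ := ((i / M : ℕ) : ℝ)
  set p : ℝ := ((i % M : ℕ) : ℝ)
  have hp0 : 0 ≤ p := Nat.cast_nonneg _
  have hm0 : 0 ≤ m := Nat.cast_nonneg _
  have hpL : p * L * κ ≤ M * L * κ := by gcongr
  have hpL0 : 0 ≤ p * L * κ := by positivity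
  have htime : (m + p * L) * κ ≤ N * τ := by
    have h1 : m * κ ≤ q * (M * L + 1) * κ := mul_le_mul_of_nonneg_right hstart' hκ.le
    have h2 : (q + 1) * ((M * L + 1) * κ) ≤ (N / (M + 1) : ℕ) * ((M * L + 1) * κ) :=
      mul_le_mul_of_nonneg_right hj' (by positivity)
    nlinarith
  have hd' := abs_le.1 (hd (m * κ) ((m + p * L) * κ) (by positivity) (by linarith) htime
    (by linarith))
  have hiτ : (i : ℝ) * τ = q * (M * L) * κ + p * L * κ := by rw [← hi', ← hLκ]; ring
  have hshift : |α ((m + p * L) * κ) - i * τ| ≤ 2 * κ := by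
    rw [hiτ, abs_le]
    constructor <;> linarith
  have hst : sampleTime M L κ e i = (m + p * L) * κ := rfl
  have h1 := hclose _ ⟨by positivity, htime⟩
  have h2 := hmove (α ((m + p * L) * κ) - i * τ) (abs_le.1 (hshift.trans hκ1.le)) 0
    (by simp) (φ (i * τ) x) (φ (i * τ) x) (by rw [sub_zero]; linarith) (by simpa using hε₁)
  rw [hφ.map_zero, ← hφ.map_add, sub_add_cancel, dist_comm] at h2
  rw [hst]
  linarith [dist_triangle (φ (i * τ) x) (φ (α ((m + p * L) * κ)) x) (φ ((m + p * L) * κ) y),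
    min_le_right ε₂ (ρ / 2)]

end Tracking

section LocalRate

lemma negLogNN_anti {a b : ℝ≥0∞} (hab : a ≤ b) (hb : b ≠ ⊤) : negLogNN b ≤ negLogNN a := by
  by_cases ha : a = 0
  · simp [negLogNN, ha]
  have hb0 : b ≠ 0 := fun h => ha (le_antisymm (h ▸ hab) zero_le)
  simp only [negLogNN, ha, hb0, if_false]
  refine ENNReal.ofReal_le_ofReal (neg_le_neg (Real.log_le_log ?_ ?_))
  · exact ENNReal.toReal_pos ha (ne_top_of_le_ne_top hb hab)
  · exact ENNReal.toReal_mono hb hab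

lemma ofReal_exp_neg_le {a : ℝ≥0∞} (ha : a ≠ ⊤) {c : ℝ} (hc : 0 ≤ c)
    (h : negLogNN a ≤ ENNReal.ofReal c) : ENNReal.ofReal (Real.exp (-c)) ≤ a := by
  have ha0 : a ≠ 0 := by
    rintro rfl
    simp [negLogNN] at h
  simp only [negLogNN, ha0, if_false] at h
  rw [ENNReal.ofReal_le_ofReal_iff hc] at h
  rw [ENNReal.ofReal_le_iff_le_toReal ha, ← Real.le_log_iff_exp_le (ENNReal.toReal_pos ha0 ha)]
  linarith

lemma measurable_negLogNN : Measurable negLogNN :=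
  Measurable.ite (measurableSet_singleton 0) measurable_const
    (ENNReal.measurable_ofReal.comp (Real.measurable_log.comp ENNReal.measurable_toReal).neg)

lemma reparBall_subset_tracingBall [PseudoMetricSpace X] {φ : ℝ → X → X} {x : X} {s t ε : ℝ}
    (hs : 0 ≤ s) (hst : s ≤ t) : reparBall φ x t ε ⊆ tracingBall φ x s ε := by
  rintro y ⟨α, ⟨hα, -, hα0⟩, hclose⟩
  have h0t : (0 : ℝ) ≤ t := hs.trans hst
  refine ⟨IccExtend h0t ((Icc 0 t).domRestrict α), ?_, ?_, fun r hr => ?_⟩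
  · exact (continuousOn_iff_continuous_domRestrict.1 hα).Icc_extend'
  · rw [IccExtend_of_mem h0t _ ⟨le_rfl, h0t⟩]
    exact hα0
  · have hr' : r ∈ Icc 0 t := ⟨hr.1, hr.2.trans hst⟩
    rw [IccExtend_of_mem h0t _ hr']
    exact hclose r hr'

variable {φ : ℝ → X → X}

lemma IsFlow.isOpen_tracingBall [MetricSpace X] (hφ : IsFlow φ) (t ε : ℝ) :
    IsOpen {p : X × X | p.2 ∈ tracingBall φ p.1 t ε} := by
  rw [isOpen_iff_eventually]
  rintro ⟨x, y⟩ ⟨α, hα, hα0, hclose⟩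
  have hcont : Continuous fun q : (X × X) × ℝ => dist (φ (α q.2) q.1.1) (φ q.2 q.1.2) :=
    (hφ.cont.comp (f := fun q : (X × X) × ℝ => (α q.2, q.1.1)) (by fun_prop)).dist
      (hφ.cont.comp (f := fun q : (X × X) × ℝ => (q.2, q.1.2)) (by fun_prop))
  have := (isCompact_Icc : IsCompact (Icc 0 t)).eventually_forall_of_forall_eventually
    (x₀ := (x, y)) (P := fun p s => dist (φ (α s) p.1) (φ s p.2) < ε)
    fun s hs => hcont.continuousAt.eventually_lt continuousAt_const (hclose s hs)
  filter_upwards [this] with p hp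
  exact ⟨α, hα, hα0, hp⟩

/-- Pulling back a tracing ball along the flow gives a subset of a longer tracing ball. -/
lemma IsFlow.exists_preimage_tracingBall_subset [MetricSpace X] [CompactSpace X] (hφ : IsFlow φ)
    {τ : ℝ} (hτ : 0 < τ) {ε : ℝ} (hε : 0 < ε) : ∃ ε₀ > 0, ∀ ε' ≤ ε₀, ∀ (x : X) (t : ℝ), 0 ≤ t →
      φ τ ⁻¹' tracingBall φ (φ τ x) t ε' ⊆ tracingBall φ x (t + τ) ε := by
  obtain ⟨ε₁, hε₁, hunif⟩ := hφ.exists_dist_lt τ hε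
  refine ⟨min ε₁ ε, lt_min hε₁ hε, fun ε' hε' x t ht => ?_⟩
  rintro y ⟨α, hα, hα0, hclose⟩
  refine ⟨fun s => min s τ + α (max (s - τ) 0), by fun_prop, ?_, fun s hs => ?_⟩
  · simp [hα0, hτ.le]
  beta_reduce
  rcases le_total s τ with h | h
  · rw [min_eq_left h, max_eq_right (by linarith), hα0, add_zero]
    have h0 := hclose 0 ⟨le_rfl, ht⟩
    rw [hα0, hφ.map_zero, hφ.map_zero] at h0
    have hmem : s - τ ∈ Icc (-τ) τ := ⟨by linarith [hs.1], by linarith⟩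
    have := hunif (s - τ) hmem (s - τ) hmem _ _ (by simpa using hε₁)
      (h0.trans_le (hε'.trans (min_le_left _ _)))
    rwa [← hφ.map_add, ← hφ.map_add, sub_add_cancel] at this
  · rw [min_eq_right h, max_eq_left (by linarith)]
    have := hclose (s - τ) ⟨by linarith, by linarith [hs.2]⟩
    rw [← hφ.map_add, ← hφ.map_add, sub_add_cancel, add_comm (α _)] at this
    exact this.trans_le (hε'.trans (min_le_right _ _))

variable [MeasurableSpace X]

/-- The exponential decay rate of the measure of the tracing balls of radius `1 / (m + 1)`
along multiples of `τ`. -/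
noncomputable def tracingRate [PseudoMetricSpace X] (μ : Measure X) (φ : ℝ → X → X) (τ : ℝ)
    (m : ℕ) (x : X) : ℝ≥0∞ :=
  liminf (fun n : ℕ => negLogNN (μ (tracingBall φ x (n * τ) (1 / (m + 1)))) /
    ENNReal.ofReal ((n + 1) * τ)) atTop

/-- A variant of the lower local entropy with good measurability and invariance properties. -/
noncomputable def tracingEnt [PseudoMetricSpace X] (μ : Measure X) (φ : ℝ → X → X) (τ : ℝ)
    (x : X) : ℝ≥0∞ :=
  ⨆ m : ℕ, tracingRate μ φ τ m x

lemma tracingEnt_le_lowerLocalEnt [PseudoMetricSpace X] (μ : Measure X) [IsFiniteMeasure μ]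
    {τ : ℝ} (hτ : 0 < τ) (x : X) : tracingEnt μ φ τ x ≤ lowerLocalEnt μ φ x := by
  refine iSup_le fun m => ?_
  refine le_iSup₂_of_le (1 / (m + 1 : ℝ)) (by positivity) ?_
  have hfloor : Tendsto (fun t : ℝ => ⌊t / τ⌋₊) atTop atTop :=
    tendsto_nat_floor_atTop.comp (tendsto_id.atTop_div_const hτ)
  refine (liminf_le_liminf_of_le hfloor).trans ?_
  rw [← Filter.liminf_comp]
  refine liminf_le_liminf ?_
  filter_upwards [eventually_ge_atTop 0] with t ht
  have h1 := Nat.floor_le (div_nonneg ht hτ.le)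
  have h2 := (Nat.lt_floor_add_one (t / τ)).le
  rw [le_div_iff₀ hτ] at h1
  rw [div_le_iff₀ hτ] at h2
  simp only [localRate, Function.comp]
  gcongr
  exact negLogNN_anti (measure_mono (reparBall_subset_tracingBall (by positivity) h1))
    (measure_ne_top _ _)

variable [MetricSpace X] [CompactSpace X] [BorelSpace X]

lemma IsFlow.measurable_negLogNN_tracingBall (hφ : IsFlow φ) (μ : Measure X) [SFinite μ]
    (t ε : ℝ) : Measurable fun x => negLogNN (μ (tracingBall φ x t ε)) :=
  measurable_negLogNN.comp
    (measurable_measure_prodMk_left (hφ.isOpen_tracingBall t ε).measurableSet)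

lemma IsFlow.measurable_tracingEnt (hφ : IsFlow φ) (μ : Measure X) [SFinite μ] (τ : ℝ) :
    Measurable (tracingEnt μ φ τ) :=
  Measurable.iSup fun _ => Measurable.liminf fun _ =>
    (hφ.measurable_negLogNN_tracingBall μ _ _).div_const _

lemma IsFlow.tracingEnt_le_map (hφ : IsFlow φ) {μ : Measure X} [IsFiniteMeasure μ]
    (hinv : FlowInvariant φ μ) {τ : ℝ} (hτ : 0 < τ) (x : X) :
    tracingEnt μ φ τ x ≤ tracingEnt μ φ τ (φ τ x) := by
  refine iSup_le fun m => ?_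
  obtain ⟨ε₀, hε₀, hsub⟩ := hφ.exists_preimage_tracingBall_subset hτ
    (Nat.one_div_pos_of_nat (α := ℝ) (n := m))
  obtain ⟨m', hm'⟩ := exists_nat_one_div_lt hε₀
  refine le_trans ?_ (le_iSup _ m')
  rw [tracingRate, ← liminf_nat_add _ 1]
  refine liminf_le_liminf (Eventually.of_forall fun n => ?_)
  have hmeas : MeasurableSet (tracingBall φ (φ τ x) (n * τ) (1 / (m' + 1))) :=
    measurable_prodMk_left (hφ.isOpen_tracingBall (n * τ) (1 / (m' + 1))).measurableSet
  have hle := measure_mono (μ := μ) (hsub _ hm'.le x (n * τ) (by positivity))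
  rw [(hinv τ).measure_preimage hmeas.nullMeasurableSet] at hle
  refine ENNReal.div_le_div ?_ (ENNReal.ofReal_le_ofReal ?_)
  · refine negLogNN_anti ?_ (measure_ne_top _ _)
    rwa [show ((n + 1 : ℕ) : ℝ) * τ = n * τ + τ by push_cast; ring]
  · push_cast
    gcongr
    linarith

lemma IsFlow.tracingEnt_le_iterate (hφ : IsFlow φ) {μ : Measure X} [IsFiniteMeasure μ]
    (hinv : FlowInvariant φ μ) {τ : ℝ} (hτ : 0 < τ) (x : X) (n : ℕ) :
    tracingEnt μ φ τ x ≤ tracingEnt μ φ τ ((φ τ)^[n] x) := by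
  induction n with
  | zero => simp
  | succ n ih =>
    rw [Function.iterate_succ_apply']
    exact ih.trans (hφ.tracingEnt_le_map hinv hτ _)

omit [CompactSpace X] [BorelSpace X] in
lemma frequently_of_tracingEnt_lt {μ : Measure X} {τ : ℝ} (hτ : 0 < τ) {x : X} {a : ℝ≥0∞}
    (h : tracingEnt μ φ τ x < a) (m : ℕ) :
    ∃ᶠ n : ℕ in atTop, negLogNN (μ (tracingBall φ x (n * τ) (1 / (m + 1)))) ≤
      a * ENNReal.ofReal ((n + 1) * τ) := by
  have h' : tracingRate μ φ τ m x < a := (le_iSup (tracingRate μ φ τ · x) m).trans_lt h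
  refine (frequently_lt_of_liminf_lt (by isBoundedDefault) h').mono fun n hn => ?_
  have hpos : 0 < ((n : ℝ) + 1) * τ := by positivity
  exact (ENNReal.div_le_iff (ENNReal.ofReal_pos.2 hpos).ne' ENNReal.ofReal_ne_top).1 hn.le

end LocalRate

section Assembly

/-- Block weights that dominate, up to subexponential factors, given sub-probabilities on words,
with a lower bound on the weights of single letters. -/
lemma exists_block_weights {A : Type*} [Fintype A] [Nonempty A] {q : ∀ n, (Fin n → A) → ℝ≥0∞}
    (hq : ∀ n, ∑ v, q n v ≤ 1) {δ : ℝ} (hδ : 0 < δ) :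
    ∃ u : ∀ n, (Fin n → A) → ℝ≥0∞, (∀ N, ∑ j ∈ Finset.range N, ∑ v, u (j + 1) v ≤ 1) ∧
      (∃ C : ℝ, 0 ≤ C ∧ ∀ v, ENNReal.ofReal (Real.exp (-C)) ≤ u 1 v) ∧
      ∃ c : ℝ, ∀ (n : ℕ) v, ENNReal.ofReal (Real.exp (-(δ * n + c))) * q n v ≤ u n v := by
  have hr1 : Real.exp (-δ) < 1 := Real.exp_lt_one_iff.2 (by linarith)
  have hr0 := Real.exp_pos (-δ)
  have hh : 0 < (1 - Real.exp (-δ)) / 2 := by linarith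
  obtain ⟨c, hc⟩ : ∃ c, c = -Real.log ((1 - Real.exp (-δ)) / 2) := ⟨_, rfl⟩
  have hexpc : Real.exp (-c) = (1 - Real.exp (-δ)) / 2 := by rw [hc, neg_neg, Real.exp_log hh]
  have hc0 : 0 ≤ c := by
    rw [hc, Left.nonneg_neg_iff]
    exact Real.log_nonpos hh.le (by linarith)
  have hA : (1 : ℝ) ≤ Fintype.card A := by exact_mod_cast Fintype.card_pos
  have hAlog : 0 ≤ Real.log (Fintype.card A) := Real.log_nonneg hA
  refine ⟨fun n v => ENNReal.ofReal (Real.exp (-(δ * n + c))) *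
    ((Fintype.card A : ℝ≥0∞)⁻¹ ^ n + q n v), fun N => ?_,
    ⟨δ + c + Real.log (Fintype.card A), by positivity, fun v => ?_⟩, c, fun n v => ?_⟩
  · have hword : ∀ n, ∑ v : Fin n → A, ((Fintype.card A : ℝ≥0∞)⁻¹ ^ n + q n v) ≤ 2 := by
      intro n
      rw [Finset.sum_add_distrib, ← one_add_one_eq_two]
      refine add_le_add ?_ (hq n)
      rw [Finset.sum_const, Finset.card_univ, Fintype.card_fun, Fintype.card_fin, nsmul_eq_mul,
        Nat.cast_pow, ← mul_pow]
      exact pow_le_one' (ENNReal.mul_inv_le_one _) n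
    have hgeom : ∑ j ∈ Finset.range N, Real.exp (-(δ * (j + 1 : ℕ) + c)) ≤ 1 / 2 := by
      have hterm : ∀ j : ℕ, Real.exp (-(δ * (j + 1 : ℕ) + c)) ≤
          (1 - Real.exp (-δ)) / 2 * Real.exp (-δ) ^ j := by
        intro j
        rw [← hexpc, ← Real.exp_nat_mul, ← Real.exp_add, Real.exp_le_exp]
        push_cast
        nlinarith
      refine (Finset.sum_le_sum fun j _ => hterm j).trans ?_
      rw [← Finset.mul_sum, div_mul_eq_mul_div, mul_neg_geom_sum]
      have := pow_pos hr0 N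
      linarith
    calc _ ≤ ∑ j ∈ Finset.range N, ENNReal.ofReal (Real.exp (-(δ * (j + 1 : ℕ) + c))) * 2 := by
          refine Finset.sum_le_sum fun j _ => ?_
          rw [← Finset.mul_sum]
          exact mul_le_mul_right (hword _) _
      _ ≤ ENNReal.ofReal (1 / 2) * 2 := by
          rw [← Finset.sum_mul, ← ENNReal.ofReal_sum_of_nonneg fun _ _ => (Real.exp_pos _).le]
          gcongr
      _ = 1 := by
          rw [show (2 : ℝ≥0∞) = ENNReal.ofReal 2 by simp, ← ENNReal.ofReal_mul (by norm_num)]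
          norm_num
  · refine le_trans (le_of_eq ?_) (mul_le_mul_right (le_add_of_nonneg_right zero_le) _)
    rw [pow_one, ← ENNReal.ofReal_natCast, ← ENNReal.ofReal_inv_of_pos (by linarith),
      ← ENNReal.ofReal_mul (Real.exp_pos _).le, neg_add, Real.exp_add,
      Real.exp_neg (Real.log _), Real.exp_log (by linarith)]
    simp
  · exact mul_le_mul_right (le_add_of_nonneg_left zero_le) _

variable [MeasurableSpace X]

/-- A finite measurable partition can be read off robustly outside of a set of small measure. -/
lemma exists_robust_coding [MetricSpace X] [CompactSpace X] [BorelSpace X] (μ : Measure X)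
    [IsFiniteMeasure μ] {A : Type*} [Fintype A] [MeasurableSpace A] [MeasurableSingletonClass A]
    {P : X → A} (hP : Measurable P) {η : ℝ≥0∞} (hη : η ≠ 0) :
    ∃ K : Set X, MeasurableSet K ∧ μ Kᶜ ≤ η ∧ ∃ ρ > 0, ∃ U : A → Set X,
      (∀ a, MeasurableSet (U a)) ∧ Pairwise (Function.onFun Disjoint U) ∧
      ∀ x ∈ K, ∀ z, dist x z < ρ → z ∈ U (P x) := by
  have hη' : η / Fintype.card A ≠ 0 := ENNReal.div_ne_zero.2 ⟨hη, ENNReal.natCast_ne_top _⟩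
  have hK : ∀ a, ∃ K ⊆ P ⁻¹' {a}, IsCompact K ∧ μ (P ⁻¹' {a} \ K) < η / Fintype.card A := fun a =>
    (hP (measurableSet_singleton a)).exists_isCompact_sdiff_lt (measure_ne_top _ _) hη'
  choose K hKP hKc hKμ using hK
  have hev : ∀ᶠ ρ in 𝓝[>] (0 : ℝ), ∀ a b, a ≠ b →
      Disjoint (Metric.thickening ρ (K a)) (Metric.thickening ρ (K b)) := by
    refine eventually_all.2 fun a => eventually_all.2 fun b => ?_
    by_cases hab : a = b
    · exact Eventually.of_forall fun _ h => absurd hab h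
    have hdisj : Disjoint (K a) (K b) :=
      (Disjoint.preimage P (Set.disjoint_singleton.2 hab)).mono (hKP a) (hKP b)
    obtain ⟨ρ, hρ, h⟩ := hdisj.exists_thickenings (hKc a) (hKc b).isClosed
    filter_upwards [Ioo_mem_nhdsGT hρ] with r hr _
    exact h.mono (Metric.thickening_mono hr.2.le _) (Metric.thickening_mono hr.2.le _)
  obtain ⟨ρ, hdisj, hρ⟩ := (hev.and self_mem_nhdsWithin).exists
  refine ⟨⋃ a, K a, MeasurableSet.iUnion fun a => (hKc a).measurableSet, ?_, ρ, hρ,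
    fun a => Metric.thickening ρ (K a), fun a => Metric.isOpen_thickening.measurableSet,
    fun a b hab => hdisj a b hab, fun x hx z hz => ?_⟩
  · have hsub : (⋃ a, K a)ᶜ ⊆ ⋃ a ∈ (Finset.univ : Finset A), P ⁻¹' {a} \ K a := by
      intro x hx
      simp only [mem_compl_iff, mem_iUnion, not_exists] at hx
      simp only [Finset.mem_univ, iUnion_true, mem_iUnion]
      exact ⟨P x, rfl, hx _⟩
    refine (measure_mono hsub).trans ((measure_biUnion_finset_le _ _).trans ?_)
    refine (Finset.sum_le_sum fun a _ => (hKμ a).le).trans ?_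
    rw [Finset.sum_const, Finset.card_univ, nsmul_eq_mul]
    exact ENNReal.mul_div_le
  · obtain ⟨a, ha⟩ := mem_iUnion.1 hx
    rw [show P x = a from hKP a ha]
    exact Metric.mem_thickening_iff.2 ⟨x, ha, by rwa [dist_comm]⟩

/-- A channel that reads a letter `a` on `U a`, up to a small noise of uniform density. -/
lemma exists_channel {A : Type*} [Fintype A] [Nonempty A] {δ : ℝ} (hδ : 0 < δ) :
    ∃ D : ℝ, 0 ≤ D ∧ ∀ U : A → Set X, (∀ a, MeasurableSet (U a)) →
      Pairwise (Function.onFun Disjoint U) → ∃ ν : A → X → ℝ≥0∞, (∀ a, Measurable (ν a)) ∧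
        (∀ x, ∑ a, ν a x ≤ 1) ∧ (∀ a, ∀ x ∈ U a, ENNReal.ofReal (Real.exp (-δ)) ≤ ν a x) ∧
        ∀ a x, ENNReal.ofReal (Real.exp (-D)) ≤ ν a x := by
  have hr1 : Real.exp (-δ) < 1 := Real.exp_lt_one_iff.2 (by linarith)
  have hA : (1 : ℝ) ≤ Fintype.card A := by exact_mod_cast Fintype.card_pos
  have hA0 : (0 : ℝ) < Fintype.card A := by linarith
  have hpos : 0 < (1 - Real.exp (-δ)) / Fintype.card A := div_pos (by linarith) hA0
  refine ⟨-Real.log ((1 - Real.exp (-δ)) / Fintype.card A), ?_, fun U hU hdisj => ?_⟩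
  · rw [Left.nonneg_neg_iff]
    refine Real.log_nonpos hpos.le ((div_le_one hA0).2 ?_)
    linarith [Real.exp_pos (-δ)]
  refine ⟨fun a x => ENNReal.ofReal (Real.exp (-δ)) * (U a).indicator 1 x +
    ENNReal.ofReal ((1 - Real.exp (-δ)) / Fintype.card A), fun a => ?_, fun x => ?_,
    fun a x hx => ?_, fun a x => ?_⟩
  · exact ((measurable_one.indicator (hU a)).const_mul _).add_const _
  · have hind : ∑ a, (U a).indicator (1 : X → ℝ≥0∞) x ≤ 1 := by
      by_cases h : ∃ a, x ∈ U a
      · obtain ⟨a, ha⟩ := h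
        rw [Fintype.sum_eq_single a fun b hb => indicator_of_notMem
          (fun hxb => Set.disjoint_left.1 (hdisj hb) hxb ha) _]
        simp [ha]
      · push Not at h
        simp [h]
    rw [Finset.sum_add_distrib, ← Finset.mul_sum, Finset.sum_const, Finset.card_univ,
      nsmul_eq_mul, ← ENNReal.ofReal_natCast, ← ENNReal.ofReal_mul hA0.le,
      mul_div_cancel₀ _ hA0.ne']
    refine (add_le_add_left (mul_le_of_le_one_right' hind) _).trans (le_of_eq ?_)
    rw [← ENNReal.ofReal_add (Real.exp_pos _).le (by linarith)]
    simp
  · simp [hx]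
  · rw [neg_neg, Real.exp_log hpos]
    exact le_add_of_nonneg_left zero_le

end Assembly

section Main

variable {φ : ℝ → X → X} [MetricSpace X] [CompactSpace X] [MeasurableSpace X] [BorelSpace X]

/-- The entropy of a measurable partition is bounded by the integral of `tracingEnt`, up to an
error that vanishes with `δ`. -/
lemma IsFlow.limsup_partEnt_le_tracingEnt (hφ : IsFlow φ) (hfp : FixedPointFree φ)
    {μ : Measure X} [IsProbabilityMeasure μ] (hinv : FlowInvariant φ μ) {τ : ℝ} (hτ : 0 < τ)
    (hfin : ∫⁻ x, tracingEnt μ φ τ x ∂μ ≠ ⊤) {A : Type*} [Fintype A] [Inhabited A]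
    [MeasurableSpace A] [MeasurableSingletonClass A] {P : X → A} (hP : Measurable P) {δ : ℝ}
    (hδ : 0 < δ) (hδ1 : δ ≤ 1) :
    limsup (fun n : ℕ =>
      ENNReal.ofReal (partEnt μ (fun x => fun j : Fin n => P ((φ τ)^[(j : ℕ)] x)) / n)) atTop ≤
      ENNReal.ofReal (6 * δ + (1 + δ) * τ * ((∫⁻ x, tracingEnt μ φ τ x ∂μ).toReal + δ)) := by
  obtain ⟨D, hD, hchannel⟩ := exists_channel (X := X) (A := A) hδ
  obtain ⟨K, hK, hKμ, ρ, hρ, U, hU, hUdisj, hKU⟩ := exists_robust_coding μ hP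
    (η := ENNReal.ofReal (δ / (D + 1))) (ENNReal.ofReal_pos.2 (by positivity)).ne'
  obtain ⟨ν, hν, hν1, hνU, hνD⟩ := hchannel U hU hUdisj
  obtain ⟨M, hM⟩ := exists_nat_gt (max (3 / δ) (Real.log 3 / δ))
  rw [max_lt_iff, div_lt_iff₀ hδ, div_lt_iff₀ hδ] at hM
  have hM0 : 1 ≤ M := by
    rcases Nat.eq_zero_or_pos M with h | h
    · simp [h] at hM
      linarith
    · exact h
  have hM1 : (1 : ℝ) ≤ M := by exact_mod_cast hM0
  obtain ⟨ε, hε, L, κ, htrace⟩ := hφ.exists_sampleTime hfp hτ hρ hM0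
  obtain ⟨m, hm⟩ := exists_nat_one_div_lt hε
  let S : ∀ n : ℕ, (Fin (n / M) → Fin 3) → ℕ → X → X :=
    fun n e i => φ (sampleTime M L κ (wordExt e) i)
  have hS : ∀ n e i, Measurable (S n e i) := fun n e i => (hφ.continuous_apply _).measurable
  obtain ⟨u, hu, ⟨C, hC, huC⟩, c, huc⟩ := exists_block_weights
    (q := fun n (v : Fin n → A) => noisyCode μ ν (S n) v)
    (fun n => sum_noisyCode_le_one hν hν1 (hS n) n) hδ
  obtain ⟨b₀, hb₀⟩ := exists_nat_gt (max (3 / δ) (c / δ))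
  rw [max_lt_iff, div_lt_iff₀ hδ, div_lt_iff₀ hδ] at hb₀
  let g : X → ℝ := fun x => (tracingEnt μ φ τ x).toReal
  have hGmeas := hφ.measurable_tracingEnt μ τ
  have hgmeas : Measurable g := hGmeas.ennreal_toReal
  have hg0 : ∀ x, 0 ≤ g x := fun x => ENNReal.toReal_nonneg
  have hgint : Integrable g μ := integrable_toReal_of_lintegral_ne_top hGmeas.aemeasurable hfin
  have hgtop : ∀ᵐ x ∂μ, tracingEnt μ φ τ x < ⊤ := ae_lt_top hGmeas hfin
  have hgI : ∫ x, g x ∂μ = (∫⁻ x, tracingEnt μ φ τ x ∂μ).toReal :=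
    integral_toReal hGmeas.aemeasurable hgtop
  -- points whose tracing balls are too small over a long range of times
  let bad : ℕ → Set X := fun N => {x | ∀ n < N, b₀ * (M + 1) ≤ n →
    ENNReal.ofReal ((g x + δ) * ((n + 1) * τ)) < negLogNN (μ (tracingBall φ x (n * τ)
      (1 / (m + 1))))}
  have hbadm : ∀ N, MeasurableSet (bad N) := fun N => by
    have : bad N = ⋂ n ∈ {n | n < N ∧ b₀ * (M + 1) ≤ n}, {x | ENNReal.ofReal ((g x + δ) *
        ((n + 1) * τ)) < negLogNN (μ (tracingBall φ x (n * τ) (1 / (m + 1))))} := by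
      ext x
      simp [bad]
    rw [this]
    refine MeasurableSet.biInter (Set.to_countable _) fun n _ => measurableSet_lt ?_
      (hφ.measurable_negLogNN_tracingBall μ _ _)
    exact ((hgmeas.add_const _).mul_const _).ennreal_ofReal
  have hbad0 : μ (⋂ N, bad N) = 0 := by
    refine measure_mono_null (t := {x | ¬ tracingEnt μ φ τ x < ⊤}) ?_ (ae_iff.1 hgtop)
    intro x hx htop
    have hlt : tracingEnt μ φ τ x < ENNReal.ofReal (g x + δ) := by
      rw [ENNReal.lt_ofReal_iff_toReal_lt htop.ne]
      exact lt_add_of_pos_right _ hδ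
    obtain ⟨n, hn, hle⟩ :=
      frequently_atTop.1 (frequently_of_tracingEnt_lt hτ hlt m) (b₀ * (M + 1))
    have := mem_iInter.1 hx (n + 1) n (Nat.lt_succ_self n) hn
    rw [ENNReal.ofReal_mul (add_nonneg (hg0 x) hδ.le)] at this
    exact absurd hle (not_le.2 this)
  obtain ⟨N₀, hN₀⟩ : ∃ N₀, μ (bad N₀) < ENNReal.ofReal (δ / (C + 1)) := by
    have hlim := tendsto_measure_iInter_atTop (μ := μ) (s := bad)
      (fun N => (hbadm N).nullMeasurableSet)
      (fun N N' h x hx n hn => hx n (hn.trans_le h)) ⟨0, measure_ne_top _ _⟩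
    rw [hbad0] at hlim
    exact (hlim.eventually_lt_const (ENNReal.ofReal_pos.2 (by positivity))).exists
  let f : X → ℝ := fun x => 4 * δ + Kᶜ.indicator (fun _ => D) x + (1 + δ) * τ * (g x + δ) +
    (bad N₀).indicator (fun _ => C) x
  have hindD : ∀ x, 0 ≤ Kᶜ.indicator (fun _ => D) x := indicator_nonneg fun _ _ => hD
  have hindC : ∀ x, 0 ≤ (bad N₀).indicator (fun _ => C) x := indicator_nonneg fun _ _ => hC
  have hgδ : ∀ x, 0 ≤ (1 + δ) * τ * (g x + δ) := fun x =>
    mul_nonneg (by positivity) (add_nonneg (hg0 x) hδ.le)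
  have hf0 : ∀ x, 0 ≤ f x := fun x => by
    simp only [f]
    linarith [hindD x, hindC x, hgδ x]
  have hDint : Integrable (Kᶜ.indicator (fun _ => D)) μ := (integrable_const D).indicator hK.compl
  have hCint : Integrable ((bad N₀).indicator (fun _ => C)) μ :=
    (integrable_const C).indicator (hbadm N₀)
  have hgδint : Integrable (fun x => (1 + δ) * τ * (g x + δ)) μ :=
    (hgint.add (integrable_const δ)).const_mul _
  have hδDint : Integrable (fun x => 4 * δ + Kᶜ.indicator (fun _ => D) x) μ :=
    (integrable_const _).add hDint
  have hδDgint : Integrable (fun x => 4 * δ + Kᶜ.indicator (fun _ => D) x +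
      (1 + δ) * τ * (g x + δ)) μ := hδDint.add hgδint
  have hfint : Integrable f μ := hδDgint.add hCint
  have hfI : ∫ x, f x ∂μ ≤
      6 * δ + (1 + δ) * τ * ((∫⁻ x, tracingEnt μ φ τ x ∂μ).toReal + δ) := by
    have hsmall : ∀ (B : Set X) (E : ℝ), 0 ≤ E → μ B ≤ ENNReal.ofReal (δ / (E + 1)) →
        μ.real B * E ≤ δ := by
      intro B E hE hB
      have h1 : μ.real B ≤ δ / (E + 1) := ENNReal.toReal_le_of_le_ofReal (by positivity) hB
      have h2 : δ / (E + 1) * (E + 1) = δ := div_mul_cancel₀ _ (by positivity)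
      nlinarith [measureReal_nonneg (μ := μ) (s := B)]
    have h1 := hsmall _ _ hD hKμ
    have h2 := hsmall _ _ hC hN₀.le
    simp only [f]
    rw [integral_add hδDgint hCint, integral_add hδDint hgδint,
      integral_add (integrable_const _) hDint, integral_const_mul ((1 + δ) * τ),
      integral_add hgint (integrable_const _), hgI, integral_indicator_const _ hK.compl,
      integral_indicator_const _ (hbadm N₀)]
    simp only [integral_const, probReal_univ, smul_eq_mul, one_mul]
    linarith
  refine le_trans (limsup_partEnt_le (hinv τ) hP hu hf0 hfint hC (N₀ := N₀ + 1) huC ?_)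
    (ENNReal.ofReal_le_ofReal hfI)
  filter_upwards [ae_all_iff.2 fun i : ℕ => ((hinv τ).iterate i).quasiMeasurePreserving.ae hgtop]
    with x hx
  by_cases hxbad : x ∈ bad N₀
  · refine ⟨1, le_rfl, by omega, le_trans (ENNReal.ofReal_le_ofReal ?_) (huC _)⟩
    rw [Real.exp_le_exp, neg_le_neg_iff]
    simp only [Finset.sum_range_one, Function.iterate_zero, id, f, indicator_of_mem hxbad]
    linarith [hindD x, hgδ x]
  simp only [bad, Set.mem_ofPred_eq] at hxbad
  push Not at hxbad
  obtain ⟨N, hN, hbN, hrate⟩ := hxbad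
  have hball := ofReal_exp_neg_le (measure_ne_top _ _)
    (mul_nonneg (add_nonneg (hg0 x) hδ.le) (by positivity)) hrate
  set b := N / (M + 1) with hb
  have hb0 : b₀ ≤ b := (Nat.le_div_iff_mul_le (by omega)).2 hbN
  have hb0' : (b₀ : ℝ) ≤ b := by exact_mod_cast hb0
  have hb₀1 : 1 ≤ b₀ := by
    rcases Nat.eq_zero_or_pos b₀ with h | h
    · simp [h] at hb₀
      linarith
    · exact h
  have hbM : b * M / M = b := Nat.mul_div_cancel _ hM0
  refine ⟨b * M, Nat.mul_le_mul (hb₀1.trans hb0) hM0, ?_, ?_⟩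
  · have : b * M ≤ N := (Nat.mul_le_mul_left b (Nat.le_succ M)).trans (Nat.div_mul_le_self _ _)
    omega
  -- the cost of the noisy channel
  have hcode := mul_measure_le_noisyCode (μ := μ) (S := S (b * M)) hν (hS (b * M))
    (v := fun i : Fin (b * M) => P ((φ τ)^[(i : ℕ)] x))
    (B := tracingBall φ x (N * τ) (1 / (m + 1)))
    (c := ENNReal.ofReal (Real.exp (-∑ i ∈ Finset.range (b * M),
      (δ + Kᶜ.indicator (fun _ => D) ((φ τ)^[i] x))))) (by
    rintro y ⟨α, hα, hα0, hclose⟩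
    obtain ⟨e, he⟩ := htrace N x y ⟨α, hα, hα0, fun s hs => (hclose s hs).trans hm⟩
    refine ⟨fun l => e l, ?_⟩
    rw [← Finset.sum_neg_distrib, Real.exp_sum,
      ENNReal.ofReal_prod_of_nonneg fun _ _ => (Real.exp_pos _).le, Finset.prod_range]
    refine Finset.prod_le_prod' fun i _ => ?_
    by_cases hi : (φ τ)^[(i : ℕ)] x ∈ K
    · rw [indicator_of_notMem (by simpa using hi), add_zero]
      refine hνU _ _ (hKU _ hi _ ?_)
      have hsame : sampleTime M L κ (wordExt fun l : Fin (b * M / M) => e l) i =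
          sampleTime M L κ e i := by
        simp only [sampleTime]
        rw [blockStart_congr _ fun l hl => wordExt_of_lt _
          (hl.trans_le (Nat.div_le_div_right i.isLt.le))]
      simp only [S]
      rw [hsame, hφ.iterate]
      exact he i i.isLt
    · rw [indicator_of_mem (by simpa using hi)]
      refine le_trans (ENNReal.ofReal_le_ofReal (Real.exp_le_exp.2 ?_)) (hνD _ _)
      linarith)
  have hcard : (Fintype.card (Fin (b * M / M) → Fin 3) : ℝ≥0∞)⁻¹ =
      ENNReal.ofReal (Real.exp (-(b * Real.log 3))) := by
    rw [hbM, Fintype.card_fun, Fintype.card_fin, Fintype.card_fin, Real.exp_neg,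
      ENNReal.ofReal_inv_of_pos (Real.exp_pos _), Real.exp_nat_mul, Real.exp_log (by norm_num),
      ENNReal.ofReal_pow (by norm_num)]
    simp
  rw [hcard] at hcode
  refine le_trans ?_ ((mul_le_mul_right ((mul_le_mul_right hball _).trans hcode) _).trans
    (huc _ _))
  rw [← ENNReal.ofReal_mul (Real.exp_pos _).le, ← ENNReal.ofReal_mul (by positivity),
    ← ENNReal.ofReal_mul (by positivity), ← Real.exp_add, ← Real.exp_add, ← Real.exp_add]
  refine ENNReal.ofReal_le_ofReal (Real.exp_le_exp.2 ?_)
  have hgmono : ∀ i : ℕ, g x ≤ g ((φ τ)^[i] x) := fun i =>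
    ENNReal.toReal_mono (hx i).ne (hφ.tracingEnt_le_iterate hinv hτ x i)
  have hsum : ∑ i ∈ Finset.range (b * M), (δ + Kᶜ.indicator (fun _ => D) ((φ τ)^[i] x)) +
      (b * M) * (3 * δ + (1 + δ) * τ * (g x + δ)) ≤
      ∑ i ∈ Finset.range (b * M), f ((φ τ)^[i] x) := by
    have : ((b : ℝ) * M) * (3 * δ + (1 + δ) * τ * (g x + δ)) =
        ∑ i ∈ Finset.range (b * M), (3 * δ + (1 + δ) * τ * (g x + δ)) := by
      rw [Finset.sum_const, Finset.card_range, nsmul_eq_mul, Nat.cast_mul]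
    rw [this, ← Finset.sum_add_distrib]
    refine Finset.sum_le_sum fun i _ => ?_
    have h1 : (1 + δ) * τ * (g x + δ) ≤ (1 + δ) * τ * (g ((φ τ)^[i] x) + δ) :=
      mul_le_mul_of_nonneg_left (add_le_add_left (hgmono i) _) (by positivity)
    simp only [f]
    linarith [hindC ((φ τ)^[i] x)]
  have hb0r : (0 : ℝ) ≤ b := Nat.cast_nonneg _
  have hcb : c ≤ b * M * δ := by nlinarith
  have hlogb : b * Real.log 3 ≤ b * M * δ := by nlinarith
  have hNb : (N : ℝ) + 1 ≤ (1 + δ) * (b * M) := by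
    have h1 : N + 1 ≤ (b + 1) * (M + 1) := by
      have := Nat.lt_div_mul_add (a := N) (b := M + 1) (by omega)
      rw [← hb] at this
      rw [Nat.succ_mul]
      omega
    have h2 : (N : ℝ) + 1 ≤ (b + 1) * (M + 1) := by exact_mod_cast h1
    have h3 : (b : ℝ) ≤ b * M * (δ / 3) := by nlinarith
    have h4 : (M : ℝ) ≤ b * M * (δ / 3) := by nlinarith
    have h5 : (1 : ℝ) ≤ b * M * (δ / 3) := by
      have : (1 : ℝ) ≤ b := by exact_mod_cast hb₀1.trans hb0
      linarith
    nlinarith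
  have hgN : (g x + δ) * ((N + 1) * τ) ≤ b * M * ((1 + δ) * τ * (g x + δ)) := by
    have := mul_le_mul_of_nonneg_right hNb (mul_nonneg (add_nonneg (hg0 x) hδ.le) hτ.le)
    linarith
  push_cast
  linarith

lemma IsFlow.kolSinai_le_tracingEnt (hφ : IsFlow φ) (hfp : FixedPointFree φ) {μ : Measure X}
    [IsProbabilityMeasure μ] (hinv : FlowInvariant φ μ) {τ : ℝ} (hτ : 0 < τ) :
    kolSinai μ (φ τ) ≤ ENNReal.ofReal τ * ∫⁻ x, tracingEnt μ φ τ x ∂μ := by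
  by_cases hfin : ∫⁻ x, tracingEnt μ φ τ x ∂μ = ⊤
  · rw [hfin, ENNReal.mul_top (ENNReal.ofReal_pos.2 hτ).ne']
    exact le_top
  refine iSup_le fun k => iSup₂_le fun P hP => ?_
  obtain ⟨x₀⟩ : Nonempty X := nonempty_of_isProbabilityMeasure μ
  have : Inhabited (Fin k) := ⟨P x₀⟩
  have hlim : Tendsto (fun δ : ℝ => ENNReal.ofReal (6 * δ + (1 + δ) * τ *
      ((∫⁻ x, tracingEnt μ φ τ x ∂μ).toReal + δ))) (𝓝[>] 0)
      (𝓝 (ENNReal.ofReal (τ * (∫⁻ x, tracingEnt μ φ τ x ∂μ).toReal))) := by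
    refine ENNReal.tendsto_ofReal (Tendsto.mono_left ?_ nhdsWithin_le_nhds)
    refine Continuous.tendsto' (by fun_prop) _ _ ?_
    simp
  rw [ENNReal.ofReal_mul hτ.le, ENNReal.ofReal_toReal hfin] at hlim
  refine ge_of_tendsto hlim ?_
  filter_upwards [Ioc_mem_nhdsGT one_pos] with δ hδ
  exact hφ.limsup_partEnt_le_tracingEnt hfp hinv hτ hfin hP hδ.1 hδ.2

omit [MetricSpace X] [CompactSpace X] [BorelSpace X] in
lemma partEnt_comp_of_measurePreserving {μ : Measure X} {T : X → X}
    (hT : MeasurePreserving T μ μ) {ι : Type*} [Fintype ι] {Z : X → ι}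
    (hZ : ∀ i, MeasurableSet (Z ⁻¹' {i})) : partEnt μ (fun x => Z (T x)) = partEnt μ Z := by
  refine Finset.sum_congr rfl fun i _ => ?_
  rw [← hT.measure_preimage (hZ i).nullMeasurableSet]
  rfl

omit [MetricSpace X] [CompactSpace X] [BorelSpace X] in
lemma partEnt_equiv_comp {μ : Measure X} {ι ι' : Type*} [Fintype ι] [Fintype ι'] (e : ι ≃ ι')
    (Z : X → ι) : partEnt μ (fun x => e (Z x)) = partEnt μ Z := by
  refine (e.sum_comp _).symm.trans (Finset.sum_congr rfl fun i _ => ?_)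
  congr 3
  ext x
  simp

omit [CompactSpace X] [BorelSpace X] in
lemma IsFlow.kolSinai_le_neg (hφ : IsFlow φ) {μ : Measure X} (hinv : FlowInvariant φ μ) (τ : ℝ) :
    kolSinai μ (φ τ) ≤ kolSinai μ (φ (-τ)) := by
  refine iSup_mono fun k => iSup₂_mono fun P hP => le_of_eq ?_
  congr 1
  funext n
  congr 2
  have hmeas : Measurable (fun x => fun j : Fin n => P ((φ (-τ))^[(j : ℕ)] x)) :=
    measurable_pi_lambda _ fun j => hP.comp ((hinv (-τ)).iterate j).measurable
  rw [← partEnt_comp_of_measurePreserving (hinv ((n - 1) * τ))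
      fun i => hmeas (measurableSet_singleton i),
    ← partEnt_equiv_comp (Equiv.arrowCongr Fin.revPerm (Equiv.refl (Fin k)))]
  congr 1
  funext x j
  simp only [Equiv.arrowCongr_apply, Function.comp, Equiv.refl_apply, Fin.revPerm_symm,
    Fin.revPerm_apply, hφ.iterate, ← hφ.map_add, Fin.val_rev]
  congr 2
  rw [Nat.cast_sub j.isLt]
  push_cast
  ring

end Main

/-- **Proposition.** For a compact metric flow `φ` without fixed points and a
`φ`-invariant Borel probability measure `μ`, for every `τ ≠ 0`,
`∫ underline h_μ(φ, x) dμ(x) ≥ (1/|τ|) h_μ(φ_τ)`. -/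
theorem le_lintegral_lowerLocalEnt {X : Type*} [MetricSpace X] [CompactSpace X]
    [MeasurableSpace X] [BorelSpace X] (φ : ℝ → X → X) (hφ : IsFlow φ)
    (hfp : FixedPointFree φ) (μ : Measure X) [IsProbabilityMeasure μ]
    (hinv : FlowInvariant φ μ) (τ : ℝ) (hτ : τ ≠ 0) :
    (ENNReal.ofReal |τ|)⁻¹ * kolSinai μ (φ τ) ≤ ∫⁻ x, lowerLocalEnt μ φ x ∂μ := by
  have key : ∀ σ : ℝ, 0 < σ →
      kolSinai μ (φ σ) ≤ ENNReal.ofReal σ * ∫⁻ x, lowerLocalEnt μ φ x ∂μ := fun σ hσ =>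
    (hφ.kolSinai_le_tracingEnt hfp hinv hσ).trans
      (mul_le_mul_right (lintegral_mono fun x => tracingEnt_le_lowerLocalEnt μ hσ x) _)
  have hpos : 0 < |τ| := abs_pos.2 hτ
  have habs : kolSinai μ (φ τ) ≤ kolSinai μ (φ |τ|) := by
    rcases le_or_gt 0 τ with h | h
    · rw [abs_of_nonneg h]
    · rw [abs_of_neg h]
      exact hφ.kolSinai_le_neg hinv τ
  rw [ENNReal.inv_mul_le_iff (ENNReal.ofReal_pos.2 hpos).ne' ENNReal.ofReal_ne_top]
  exact habs.trans (key _ hpos)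

end FlowEntropy
end

section
/- Let (X,d) be a compact metric space and φ a continuous flow on X without fixed points. For every η>0 there exists θ>0 such that for all x,y∈X, every closed interval I containing the origin, and every reparametrization α∈Rep(I): if d(φ_{α(s)}(x), φ_s(y)) < θ for all s∈I, then |α(s)−s| < η|s| whenever |s|>1, and |α(s)−s| < η whenever |s|≤1. -/
open MeasureTheory Filter Set Topology
open scoped ENNReal NNReal

namespace FlowEntropy

variable {X : Type*}

lemma IsFlow.continuous_time {X : Type*} [TopologicalSpace X] {φ : ℝ → X → X}
    (hφ : IsFlow φ) (t : ℝ) : Continuous (φ t) :=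
  hφ.cont.comp (Continuous.prodMk_right t)

/-- A fixed-point free flow on a compact space has arbitrarily small times whose
time maps have no fixed points. -/
lemma exists_small_time_no_fixed_point {X : Type*} [MetricSpace X] [CompactSpace X]
    {φ : ℝ → X → X} (hφ : IsFlow φ) (hfp : FixedPointFree φ) {ε : ℝ} (hε : 0 < ε) :
    ∃ T : ℝ, 0 < T ∧ T < ε ∧ ∀ x, φ T x ≠ x := by
  by_contra! h
  have hpos : ∀ n : ℕ, 0 < ε / 2 ^ (n + 1) := fun n => by positivity
  have hlt : ∀ n : ℕ, ε / 2 ^ (n + 1) < ε := fun n =>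
    div_lt_self hε (one_lt_pow₀ one_lt_two n.succ_ne_zero)
  obtain ⟨x, hx⟩ := IsCompact.nonempty_iInter_of_sequence_nonempty_isCompact_isClosed
    (fun n : ℕ => {x | φ (ε / 2 ^ (n + 1)) x = x})
    (fun n x hx => by
      simp only [mem_ofPred_eq] at hx ⊢
      have e : ε / 2 ^ (n + 1) = ε / 2 ^ (n + 1 + 1) + ε / 2 ^ (n + 1 + 1) := by
        field_simp; ring
      rw [e, hφ.map_add, hx, hx])
    (fun n => h _ (hpos n) (hlt n))
    (isClosed_eq (hφ.continuous_time _) continuous_id).isCompact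
    (fun n => isClosed_eq (hφ.continuous_time _) continuous_id)
  rw [mem_iInter] at hx
  let S : AddSubgroup ℝ :=
    { carrier := {t | φ t x = x}
      zero_mem' := hφ.map_zero x
      add_mem' := fun {s t} hs ht => by
        simp only [mem_ofPred_eq] at hs ht ⊢
        rw [hφ.map_add, ht, hs]
      neg_mem' := fun {t} ht => by
        simp only [mem_ofPred_eq] at ht ⊢
        conv_lhs => rw [← ht]
        rw [← hφ.map_add, neg_add_cancel, hφ.map_zero] }
  have hdense : Dense (S : Set ℝ) := AddSubgroup.dense_of_not_isolated_zero S fun δ hδ => by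
    obtain ⟨n, hn⟩ := exists_pow_lt_of_lt_one (div_pos hδ hε) (by norm_num : (1 / 2 : ℝ) < 1)
    refine ⟨ε / 2 ^ (n + 1), hx n, hpos n, ?_⟩
    rw [lt_div_iff₀ hε] at hn
    refine lt_of_le_of_lt ?_ hn
    rw [div_pow, one_pow, one_div_mul_eq_div]
    exact div_le_div_of_nonneg_left hε.le (by positivity)
      (pow_le_pow_right₀ one_le_two n.le_succ)
  have hclosed : IsClosed (S : Set ℝ) :=
    isClosed_eq (hφ.cont.comp (by fun_prop : Continuous fun t : ℝ => (t, x))) continuous_const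
  obtain ⟨t, ht⟩ := hfp x
  exact ht (hclosed.closure_eq ▸ hdense t : t ∈ (S : Set ℝ))

/-- Over time intervals of length at most one, a continuous change of time along which two
orbits stay close has increments close to those of the identity. -/
lemma exists_increment_close {X : Type*} [MetricSpace X] [CompactSpace X]
    {φ : ℝ → X → X} (hφ : IsFlow φ) (hfp : FixedPointFree φ) {ε : ℝ} (hε : 0 < ε) :
    ∃ θ : ℝ, 0 < θ ∧ ∀ x y : X, ∀ α : ℝ → ℝ, ∀ s t : ℝ, |t - s| ≤ 1 →
      ContinuousOn α (uIcc s t) →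
      (∀ u ∈ uIcc s t, dist (φ (α u) x) (φ u y) < θ) →
      |α t - α s - (t - s)| < ε := by
  obtain ⟨T, hT, hTε, hTx⟩ := exists_small_time_no_fixed_point hφ hfp hε
  obtain ⟨c, hc, hcx⟩ : ∃ c : ℝ, 0 < c ∧ ∀ x, c ≤ dist (φ T x) x := by
    obtain ⟨c, hc, h⟩ := isCompact_univ.exists_forall_le'
      ((hφ.continuous_time T).dist continuous_id).continuousOn (a := 0) fun x _ => dist_pos.2 (hTx x)
    exact ⟨c, hc, fun x => h x (mem_univ x)⟩
  have huc := (isCompact_Icc.prod isCompact_univ).uniformContinuousOn_of_continuous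
    (hφ.cont.continuousOn (s := Icc (-1 : ℝ) 1 ×ˢ (univ : Set X)))
  rw [Metric.uniformContinuousOn_iff] at huc
  obtain ⟨δ, hδ, huc⟩ := huc (c / 2) (half_pos hc)
  refine ⟨min δ (c / 2), lt_min hδ (half_pos hc), ?_⟩
  intro x y α s t hst hα hd
  by_contra! hge
  obtain ⟨u, hu, hfu⟩ : ∃ u ∈ uIcc s t, |α u - α s - (u - s)| = T := by
    have hf : ContinuousOn (fun u => |α u - α s - (u - s)|) (uIcc s t) := by fun_prop
    exact intermediate_value_uIcc hf (mem_uIcc_of_le (by simpa using hT.le) (hTε.le.trans hge))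
  have hus : |u - s| ≤ 1 := (abs_sub_left_of_mem_uIcc hu).trans hst
  have h1 := hd u hu
  have h2 : dist (φ (u - s) (φ (α s) x)) (φ (u - s) (φ s y)) < c / 2 := by
    refine huc (u - s, φ (α s) x) ⟨abs_le.1 hus, mem_univ _⟩ (u - s, φ s y)
      ⟨abs_le.1 hus, mem_univ _⟩ ?_
    rw [Prod.dist_eq]
    simpa using (hd s left_mem_uIcc).trans_le (min_le_left _ _)
  rw [← hφ.map_add, ← hφ.map_add, sub_add_cancel] at h2
  have h3 : dist (φ (α u) x) (φ (u - s + α s) x) < c := by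
    have := dist_triangle_right (φ (α u) x) (φ (u - s + α s) x) (φ u y)
    have := min_le_right δ (c / 2)
    linarith
  rcases (abs_eq hT.le).1 hfu with h | h
  · have := hcx (φ (u - s + α s) x)
    rw [← hφ.map_add, show T + (u - s + α s) = α u by linarith] at this
    linarith
  · have := hcx (φ (α u) x)
    rw [← hφ.map_add, show T + α u = u - s + α s by linarith, dist_comm] at this
    linarith

/-- **Lemma (Thomas).** For a compact metric flow without fixed points, for every `η > 0`
there is `θ > 0` so that whenever a reparametrization `α` of a closed interval `[a,b]`
containing the origin satisfies `d(φ_{α(s)}x, φ_s y) < θ` on the whole interval, then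
`|α(s) − s| < η|s|` for `|s| > 1` and `|α(s) − s| < η` for `|s| ≤ 1`. -/
theorem repar_close_to_identity {X : Type*} [MetricSpace X] [CompactSpace X]
    (φ : ℝ → X → X) (hφ : IsFlow φ) (hfp : FixedPointFree φ) :
    ∀ η : ℝ, 0 < η → ∃ θ : ℝ, 0 < θ ∧
      ∀ x y : X, ∀ a b : ℝ, a ≤ 0 → 0 ≤ b → ∀ α : ℝ → ℝ,
        IsReparOn α (Set.Icc a b) →
        (∀ s ∈ Set.Icc a b, dist (φ (α s) x) (φ s y) < θ) →
        ∀ s ∈ Set.Icc a b,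
          (1 < |s| → |α s - s| < η * |s|) ∧ (|s| ≤ 1 → |α s - s| < η) := by
  intro η hη
  obtain ⟨θ, hθ, H⟩ := exists_increment_close hφ hfp (half_pos hη)
  refine ⟨θ, hθ, fun x y a b ha hb α ⟨hα, _, hα0⟩ hd s hs => ?_⟩
  have h0 : (0 : ℝ) ∈ Icc a b := ⟨ha, hb⟩
  have step : ∀ u ∈ Icc a b, ∀ v ∈ Icc a b, |v - u| ≤ 1 →
      |α v - α u - (v - u)| < η / 2 := fun u hu v hv huv =>
    have hsub := uIcc_subset_Icc hu hv
    H x y α u v huv (hα.mono hsub) fun w hw => hd w (hsub hw)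
  refine ⟨fun h1 => ?_, fun h1 => ?_⟩
  · have hn0 : 0 < ⌈|s|⌉₊ := Nat.ceil_pos.2 (by linarith)
    have hn1 : |s| ≤ ⌈|s|⌉₊ := Nat.le_ceil _
    have hn2 : (⌈|s|⌉₊ : ℝ) < |s| + 1 := Nat.ceil_lt_add_one (abs_nonneg s)
    generalize ⌈|s|⌉₊ = n at hn0 hn1 hn2
    have hn : (0 : ℝ) < n := by exact_mod_cast hn0
    have hmem : ∀ k : ℕ, k ≤ n → (k / n : ℝ) * s ∈ Icc a b := fun k hk => by
      have hk' : (k / n : ℝ) ≤ 1 := div_le_one_of_le₀ (by exact_mod_cast hk) hn.le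
      simpa using (convex_Icc a b).smul_mem_of_zero_mem h0 hs ⟨by positivity, hk'⟩
    have key : ∀ k : ℕ, k ≤ n → |α (k / n * s) - k / n * s| ≤ k * (η / 2) := by
      intro k
      induction k with
      | zero => simp [hα0]
      | succ k ih =>
        intro hk
        have hlen : ((k + 1 : ℕ) / n : ℝ) * s - k / n * s = s / n := by
          push_cast; field_simp; ring
        have h2 := step _ (hmem k (by omega)) _ (hmem (k + 1) hk) (by
          rw [hlen, abs_div, abs_of_pos hn]
          exact div_le_one_of_le₀ hn1 hn.le)
        have h3 := ih (by omega)
        rw [abs_lt] at h2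
        rw [abs_le] at h3 ⊢
        push_cast at h2 ⊢
        constructor <;> linarith
    have := key n le_rfl
    rw [div_self hn.ne', one_mul] at this
    nlinarith
  · have := step 0 h0 s hs (by simpa using h1)
    rw [hα0, sub_zero, sub_zero] at this
    linarith

end FlowEntropy
end

section
/- Let (X,d) be a compact metric space and φ a continuous flow on X without fixed points. Let 0<η<1, t>1, and let θ>0 be a constant (depending on η) such that d(φ_{α(s)}x, φ_s y)<θ for all s in a closed interval I containing 0 implies |α(s)−s|<η|s| for |s|>1 and |α(s)−s|<η for |s|≤1, for every reparametrization α∈Rep(I). Write t̃=(1−η)t. Then for any 0<ε<θ: (1) if y∈B(x,t,ε,φ), then x∈B(y,t̃,ε,φ); (2) if y∈B(x,t,ε/2,φ), then B(x,t,ε/2,φ) ⊆ B(y,t̃,ε,φ). -/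
open MeasureTheory Filter Set Topology
open scoped ENNReal NNReal

namespace FlowEntropy

variable {X : Type*}

/-- The inverse of a continuous injection on a compact set is continuous on the image. -/
theorem continuousOn_invFunOn_image {E F : Type*} [TopologicalSpace E] [TopologicalSpace F]
    [T2Space F] [Nonempty E] {f : E → F} {K : Set E} (hK : IsCompact K)
    (hf : ContinuousOn f K) (hinj : InjOn f K) :
    ContinuousOn (Function.invFunOn f K) (f '' K) := by
  refine continuousOn_iff_isClosed.2 fun C hC =>
    ⟨f '' (K ∩ C), ((hK.inter_right hC).image_of_continuousOn
      (hf.mono inter_subset_left)).isClosed, ?_⟩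
  ext u
  constructor
  · rintro ⟨huC, v, hv, rfl⟩
    rw [mem_preimage, hinj.leftInvOn_invFunOn hv] at huC
    exact ⟨⟨v, ⟨hv, huC⟩, rfl⟩, v, hv, rfl⟩
  · rintro ⟨⟨v, ⟨hv, hvC⟩, rfl⟩, hu⟩
    exact ⟨by rwa [mem_preimage, hinj.leftInvOn_invFunOn hv], hu⟩

theorem IsReparOn.mono {α : ℝ → ℝ} {I J : Set ℝ} (hα : IsReparOn α J) (hIJ : I ⊆ J) :
    IsReparOn α I :=
  ⟨hα.1.mono hIJ, hα.2.1.mono hIJ, hα.2.2⟩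

theorem IsReparOn.mapsTo_Icc {α : ℝ → ℝ} {t : ℝ} (ht : 0 ≤ t) (hα : IsReparOn α (Icc 0 t))
    (hαt : 0 ≤ α t) : MapsTo α (Icc 0 t) (Icc 0 (α t)) := by
  have hmono := hα.1.strictMonoOn_of_injOn_Icc ht (hα.2.2.symm ▸ hαt) hα.2.1
  simpa only [hα.2.2] using hmono.monotoneOn.mapsTo_Icc

/-- An increasing reparametrization of `[0, t]` has an inverse on `[0, α t]`, which is again a
reparametrization. -/
theorem IsReparOn.exists_inverse {α : ℝ → ℝ} {t : ℝ} (ht : 0 ≤ t) (hα : IsReparOn α (Icc 0 t))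
    (hαt : 0 ≤ α t) :
    ∃ β : ℝ → ℝ, IsReparOn β (Icc 0 (α t)) ∧ MapsTo β (Icc 0 (α t)) (Icc 0 t) ∧
      RightInvOn β α (Icc 0 (α t)) := by
  have hmono := hα.1.strictMonoOn_of_injOn_Icc ht (hα.2.2.symm ▸ hαt) hα.2.1
  have himage : α '' Icc 0 t = Icc 0 (α t) := by
    simpa only [hα.2.2] using hα.1.image_Icc_of_monotoneOn ht hmono.monotoneOn
  have hsurj : SurjOn α (Icc 0 t) (Icc 0 (α t)) := himage.ge
  refine ⟨Function.invFunOn α (Icc 0 t), ⟨?_, hsurj.rightInvOn_invFunOn.injOn, ?_⟩,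
    hsurj.mapsTo_invFunOn, hsurj.rightInvOn_invFunOn⟩
  · exact himage ▸ continuousOn_invFunOn_image isCompact_Icc hα.1 hα.2.1
  · simpa only [hα.2.2] using hα.2.1.leftInvOn_invFunOn (left_mem_Icc.2 ht)

theorem IsReparOn.comp {α β : ℝ → ℝ} {I J : Set ℝ} (hβ : IsReparOn β J) (hα : IsReparOn α I)
    (hmaps : MapsTo α I J) : IsReparOn (β ∘ α) I :=
  ⟨hβ.1.comp hα.1 hmaps, hβ.2.1.comp hα.2.1 hmaps, by
    rw [Function.comp_apply, hα.2.2, hβ.2.2]⟩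

section Balls

variable [PseudoMetricSpace X] {φ : ℝ → X → X}

theorem reparBall_antitone_time {x : X} {s t ε : ℝ} (hst : s ≤ t) :
    reparBall φ x t ε ⊆ reparBall φ x s ε := fun _ ⟨α, hα, hd⟩ =>
  have hsub : Icc 0 s ⊆ Icc 0 t := Icc_subset_Icc_right hst
  ⟨α, hα.mono hsub, fun u hu => hd u (hsub hu)⟩

theorem mem_reparBall_swap {x y : X} {t ε : ℝ} {α : ℝ → ℝ} (ht : 0 ≤ t)
    (hα : IsReparOn α (Icc 0 t)) (hαt : 0 ≤ α t)
    (hd : ∀ s ∈ Icc (0 : ℝ) t, dist (φ (α s) x) (φ s y) < ε) :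
    x ∈ reparBall φ y (α t) ε := by
  obtain ⟨β, hβ, hmaps, hinv⟩ := hα.exists_inverse ht hαt
  refine ⟨β, hβ, fun s hs => ?_⟩
  simpa only [hinv hs, dist_comm] using hd (β s) (hmaps hs)

/-- If `y` and `z` shadow the orbit of `x` at scale `ε / 2` and the reparametrization for `z`
does not overtake the one for `y`, then `z` shadows the orbit of `y` at scale `ε`. -/
theorem mem_reparBall_of_common_center {x y z : X} {t ε : ℝ} {α β : ℝ → ℝ} (ht : 0 ≤ t)
    (hα : IsReparOn α (Icc 0 t)) (hβ : IsReparOn β (Icc 0 t)) (hβt : 0 ≤ β t)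
    (hβα : β t ≤ α t)
    (hdy : ∀ s ∈ Icc (0 : ℝ) t, dist (φ (α s) x) (φ s y) < ε / 2)
    (hdz : ∀ s ∈ Icc (0 : ℝ) t, dist (φ (β s) x) (φ s z) < ε / 2) :
    z ∈ reparBall φ y t ε := by
  obtain ⟨γ, hγ, hmaps, hinv⟩ := hα.exists_inverse ht (hβt.trans hβα)
  have hβmaps : MapsTo β (Icc 0 t) (Icc 0 (α t)) :=
    (hβ.mapsTo_Icc ht hβt).mono_right (Icc_subset_Icc_right hβα)
  refine ⟨γ ∘ β, hγ.comp hβ hβmaps, fun s hs => ?_⟩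
  have hy := hdy (γ (β s)) (hmaps (hβmaps hs))
  rw [hinv (hβmaps hs), dist_comm] at hy
  have := dist_triangle (φ (γ (β s)) y) (φ (β s) x) (φ s z)
  have := hdz s hs
  simp only [Function.comp_apply]
  linarith

end Balls

/-- **Lemma.** Let `0 < η < 1`, `t > 1` and let `θ` be as in Thomas' lemma. Write
`t̃ = (1−η)t`. Then for `0 < ε < θ`: (1) if `y ∈ B(x,t,ε,φ)` then `x ∈ B(y,t̃,ε,φ)`;
(2) if `y ∈ B(x,t,ε/2,φ)` then `B(x,t,ε/2,φ) ⊆ B(y,t̃,ε,φ)`. -/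
theorem reparBall_symm_and_subset {X : Type*} [MetricSpace X] [CompactSpace X]
    (φ : ℝ → X → X) (hφ : IsFlow φ) (hfp : FixedPointFree φ)
    (η t θ : ℝ) (hη0 : 0 < η) (hη1 : η < 1) (ht : 1 < t) (hθ0 : 0 < θ)
    (hθ : ∀ x y : X, ∀ a b : ℝ, a ≤ 0 → 0 ≤ b → ∀ α : ℝ → ℝ,
      IsReparOn α (Set.Icc a b) →
      (∀ s ∈ Set.Icc a b, dist (φ (α s) x) (φ s y) < θ) →
      ∀ s ∈ Set.Icc a b, (1 < |s| → |α s - s| < η * |s|) ∧ (|s| ≤ 1 → |α s - s| < η))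
    (ε : ℝ) (hε0 : 0 < ε) (hεθ : ε < θ) (x y : X) :
    (y ∈ reparBall φ x t ε → x ∈ reparBall φ y ((1 - η) * t) ε) ∧
    (y ∈ reparBall φ x t (ε / 2) →
      reparBall φ x t (ε / 2) ⊆ reparBall φ y ((1 - η) * t) ε) := by
  have ht0 : 0 ≤ t := by linarith
  have hlower : ∀ (u v : X) (δ : ℝ) (α : ℝ → ℝ), δ ≤ ε → IsReparOn α (Icc 0 t) →
      (∀ s ∈ Icc (0 : ℝ) t, dist (φ (α s) u) (φ s v) < δ) → (1 - η) * t ≤ α t := by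
    intro u v δ α hδ hα hd
    have habs : |t| = t := abs_of_nonneg ht0
    have h := (hθ u v 0 t le_rfl ht0 α hα (fun s hs => by linarith [hd s hs]) t
      (right_mem_Icc.2 ht0)).1 (habs.symm ▸ ht)
    rw [habs] at h
    linarith [(abs_lt.1 h).1]
  have hpos : 0 ≤ (1 - η) * t := mul_nonneg (by linarith) ht0
  have hswap : ∀ u v : X, v ∈ reparBall φ u t ε → u ∈ reparBall φ v ((1 - η) * t) ε := by
    rintro u v ⟨α, hα, hd⟩
    have hαt := hlower u v ε α le_rfl hα hd
    exact reparBall_antitone_time hαt (mem_reparBall_swap ht0 hα (hpos.trans hαt) hd)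
  refine ⟨hswap x y, ?_⟩
  rintro ⟨α, hα, hdy⟩ z ⟨β, hβ, hdz⟩
  have hαt := hpos.trans (hlower x y _ α (by linarith) hα hdy)
  have hβt := hpos.trans (hlower x z _ β (by linarith) hβ hdz)
  rcases le_total (β t) (α t) with hle | hle
  · exact reparBall_antitone_time (by nlinarith)
      (mem_reparBall_of_common_center ht0 hα hβ hβt hle hdy hdz)
  · exact hswap z y (mem_reparBall_of_common_center ht0 hβ hα hαt hle hdz hdy)

end FlowEntropy
end
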